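/- arXiv:2308.02232 — 4 statements merged into one kernel-verified Lean document; each statement's English description precedes it below -/
import Mathlib

section
/- Let q > 1 and m > −1 be real. Define b_k := (−1)^k / ∏_{j=1}^{k}(q^j − 1), η_∞(q) := ∏_{i=1}^{∞}(1 − q^{−i}), and c_k := b_k / (η_∞(q) · π_m(0)). Then the partial sums Σ_{k=0}^{N} c_k · (π_m ∘ q^k), where (π_m ∘ q^k)(i) := π_m(i) q^{ki}, converge in ℓ²(π_m) to δ₀ as N → ∞: explicitly, lim_{N→∞} Σ_{i=0}^{∞} π_m(i)^{−1} · |Σ_{k=0}^{N} c_k π_m(i) q^{ki} − δ₀(i)|² = 0, where δ₀(0) = 1 and δ₀(i) = 0 for i ≥ 1. -/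
noncomputable section

/-- Unnormalized weight `q^{-i(i+m)} / (η_i(q)·∏_{j=1}^{i}(1-q^{-m-j}))`. -/
def piWt (q m : ℝ) (i : ℕ) : ℝ :=
  q ^ (-((i : ℝ) * ((i : ℝ) + m))) /
    ((∏ j ∈ Finset.range i, (1 - q ^ (-((j : ℝ) + 1)))) *
      ∏ j ∈ Finset.range i, (1 - q ^ (-m - ((j : ℝ) + 1))))

/-- The stationary distribution `π_m`, normalized so that it sums to `1`. -/
def piM (q m : ℝ) (i : ℕ) : ℝ := (∑' k : ℕ, piWt q m k)⁻¹ * piWt q m i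

/-- `b_k = (−1)^k / ∏_{j=1}^{k}(q^j − 1)`. -/
def bCoef (q : ℝ) (k : ℕ) : ℝ := (-1) ^ k / ∏ j ∈ Finset.range k, (q ^ (j + 1) - 1)

/-- `η_∞(q) = ∏_{i=1}^{∞}(1 − q^{−i})`. -/
def etaInf (q : ℝ) : ℝ := ∏' i : ℕ, (1 - q⁻¹ ^ (i + 1))

/-- `c_k = b_k / (η_∞(q)·π_m(0))`. -/
def cCoef (q m : ℝ) (k : ℕ) : ℝ := bCoef q k / (etaInf q * piM q m 0)

open Filter Topology

/-- The entire function `x ↦ Σ_k b_k x^k`. -/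
def eulerSum (q x : ℝ) : ℝ := ∑' k : ℕ, bCoef q k * x ^ k

lemma bCoef_zero (q : ℝ) : bCoef q 0 = 1 := by simp [bCoef]

lemma prod_pow_sub_one_pos {q : ℝ} (hq : 1 < q) (k : ℕ) :
    0 < ∏ j ∈ Finset.range k, (q ^ (j + 1) - 1) :=
  Finset.prod_pos fun j _ => sub_pos.2 (one_lt_pow₀ hq j.succ_ne_zero)

lemma bCoef_ne_zero {q : ℝ} (hq : 1 < q) (k : ℕ) : bCoef q k ≠ 0 :=
  div_ne_zero (pow_ne_zero _ (by norm_num)) (prod_pow_sub_one_pos hq k).ne'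

lemma bCoef_succ_mul {q : ℝ} (hq : 1 < q) (k : ℕ) :
    bCoef q (k + 1) * (q ^ (k + 1) - 1) = -bCoef q k := by
  have h := (prod_pow_sub_one_pos hq k).ne'
  have h' : q ^ (k + 1) - 1 ≠ 0 := (sub_pos.2 (one_lt_pow₀ hq k.succ_ne_zero)).ne'
  unfold bCoef
  rw [Finset.prod_range_succ]
  field_simp
  ring

lemma abs_bCoef {q : ℝ} (hq : 1 < q) (k : ℕ) : |bCoef q k| = bCoef q k * (-1) ^ k := by
  have h := prod_pow_sub_one_pos hq k
  rw [bCoef, abs_div, abs_of_pos h, abs_pow, abs_neg, abs_one, one_pow, div_mul_eq_mul_div,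
    ← mul_pow]
  norm_num

lemma summable_bCoef_mul_pow {q : ℝ} (hq : 1 < q) (x : ℝ) :
    Summable fun k : ℕ => bCoef q k * x ^ k := by
  rcases eq_or_ne x 0 with rfl | hx
  · exact summable_of_ne_finset_zero (s := {0}) fun k hk => by
      rw [zero_pow (by simpa using hk), mul_zero]
  refine summable_of_ratio_test_tendsto_lt_one (l := 0) zero_lt_one
    (Eventually.of_forall fun k => mul_ne_zero (bCoef_ne_zero hq k) (pow_ne_zero _ hx)) ?_
  have hlim : Tendsto (fun k : ℕ => |x| / (q ^ (k + 1) - 1)) atTop (𝓝 0) :=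
    tendsto_const_nhds.div_atTop <| tendsto_atTop_add_const_right _ _ <|
      (tendsto_pow_atTop_atTop_of_one_lt hq).comp (tendsto_add_atTop_nat 1)
  refine hlim.congr fun k => ?_
  have hpos : 0 < q ^ (k + 1) - 1 := sub_pos.2 (one_lt_pow₀ hq k.succ_ne_zero)
  have hb := abs_pos.2 (bCoef_ne_zero hq k)
  have hx' := abs_pos.2 hx
  have key : |bCoef q (k + 1)| * (q ^ (k + 1) - 1) = |bCoef q k| := by
    rw [← abs_of_pos hpos, ← abs_mul, bCoef_succ_mul hq, abs_neg]
  rw [Real.norm_eq_abs, Real.norm_eq_abs, abs_mul, abs_mul, abs_pow, abs_pow, pow_succ |x|,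
    div_eq_div_iff hpos.ne' (by positivity), ← key]
  ring

lemma eulerSum_mul_left {q : ℝ} (hq : 1 < q) (x : ℝ) :
    eulerSum q (q * x) = (1 - x) * eulerSum q x := by
  have h1 := summable_bCoef_mul_pow hq (q * x)
  have h2 := summable_bCoef_mul_pow hq x
  have h : eulerSum q (q * x) - eulerSum q x = -(x * eulerSum q x) := by
    rw [eulerSum, eulerSum, ← h1.tsum_sub h2, (h1.sub h2).tsum_eq_zero_add, ← tsum_mul_left,
      ← tsum_neg]
    simp only [pow_zero, sub_self, zero_add]
    refine tsum_congr fun k => ?_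
    linear_combination x ^ (k + 1) * bCoef_succ_mul hq k
  linear_combination h

lemma eulerSum_zero (q : ℝ) : eulerSum q 0 = 1 := by
  rw [eulerSum, tsum_eq_single 0 fun k hk => by rw [zero_pow hk, mul_zero]]
  simp [bCoef_zero]

lemma eulerSum_pow_succ {q : ℝ} (hq : 1 < q) (i : ℕ) : eulerSum q (q ^ (i + 1)) = 0 := by
  induction i with
  | zero => simpa using eulerSum_mul_left hq 1
  | succ i ih => rw [pow_succ', eulerSum_mul_left hq, ih, mul_zero]

lemma eulerSum_one_eq_prod_mul {q : ℝ} (hq : 1 < q) (n : ℕ) :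
    eulerSum q 1 = (∏ i ∈ Finset.range n, (1 - q⁻¹ ^ (i + 1))) * eulerSum q (q⁻¹ ^ n) := by
  induction n with
  | zero => simp
  | succ n ih =>
    have hq0 : q ≠ 0 := by positivity
    have h : q⁻¹ ^ n = q * q⁻¹ ^ (n + 1) := by
      rw [pow_succ', mul_inv_cancel_left₀ hq0]
    rw [ih, Finset.prod_range_succ, h, eulerSum_mul_left hq]
    ring

lemma summable_inv_pow_succ {q : ℝ} (hq : 1 < q) : Summable fun i : ℕ => q⁻¹ ^ (i + 1) :=
  (summable_nat_add_iff 1).2 <|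
    summable_geometric_of_lt_one (by positivity) (inv_lt_one_of_one_lt₀ hq)

lemma etaInf_ne_zero {q : ℝ} (hq : 1 < q) : etaInf q ≠ 0 := by
  simp only [etaInf, sub_eq_add_neg]
  refine tprod_one_add_ne_zero_of_summable (fun i => ?_) ?_
  · have : q⁻¹ ^ (i + 1) < 1 :=
      pow_lt_one₀ (by positivity) (inv_lt_one_of_one_lt₀ hq) i.succ_ne_zero
    linarith
  · exact (summable_inv_pow_succ hq).neg.norm

lemma eulerSum_one {q : ℝ} (hq : 1 < q) : eulerSum q 1 = etaInf q := by
  have hr := inv_lt_one_of_one_lt₀ hq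
  have hr0 : 0 ≤ q⁻¹ := by positivity
  have hprod : Tendsto (fun n => ∏ i ∈ Finset.range n, (1 - q⁻¹ ^ (i + 1))) atTop
      (𝓝 (etaInf q)) := by
    simp only [etaInf, sub_eq_add_neg]
    exact (multipliable_one_add_of_summable
      (summable_inv_pow_succ hq).neg.norm).tendsto_prod_tprod_nat
  have hlim : Tendsto (fun n : ℕ => eulerSum q (q⁻¹ ^ n)) atTop (𝓝 1) := by
    rw [← eulerSum_zero q]
    refine tendsto_tsum_of_dominated_convergence
      (summable_bCoef_mul_pow hq 1).norm (fun k => ?_) (Eventually.of_forall fun n k => ?_)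
    · exact ((tendsto_pow_atTop_nhds_zero_of_lt_one hr0 hr).pow k).const_mul _
    · rw [norm_mul, norm_mul, norm_pow, norm_pow, norm_pow, norm_one, one_pow]
      gcongr
      refine pow_le_one₀ (by positivity) (pow_le_one₀ (norm_nonneg _) ?_)
      rw [Real.norm_of_nonneg hr0]
      exact hr.le
  have h := hprod.mul hlim
  rw [mul_one] at h
  exact tendsto_nhds_unique (tendsto_const_nhds.congr (eulerSum_one_eq_prod_mul hq)) h

lemma abs_partialSum_le {q : ℝ} (hq : 1 < q) {x : ℝ} (hx : 0 ≤ x) (n : ℕ) :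
    |∑ k ∈ Finset.range n, bCoef q k * x ^ k| ≤ eulerSum q (-x) := by
  have hterm (k : ℕ) : bCoef q k * (-x) ^ k = |bCoef q k * x ^ k| := by
    rw [abs_mul, abs_bCoef hq, abs_of_nonneg (pow_nonneg hx k), neg_pow, mul_assoc]
  have hs := summable_bCoef_mul_pow hq (-x)
  refine (Finset.abs_sum_le_sum_abs _ _).trans ?_
  simp_rw [← hterm]
  exact hs.sum_le_tsum _ fun k _ => by rw [hterm]; positivity

lemma one_le_eulerSum_neg {q : ℝ} (hq : 1 < q) {x : ℝ} (hx : 0 ≤ x) :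
    1 ≤ eulerSum q (-x) := by
  simpa [bCoef_zero] using abs_partialSum_le hq hx 1

lemma one_sub_rpow_pos {q x : ℝ} (hq : 1 < q) (hx : x < 0) : 0 < 1 - q ^ x :=
  sub_pos.2 (Real.rpow_lt_one_of_one_lt_of_neg hq hx)

lemma piWt_zero (q m : ℝ) : piWt q m 0 = 1 := by simp [piWt]

lemma piWt_pos {q m : ℝ} (hq : 1 < q) (hm : -1 < m) (i : ℕ) : 0 < piWt q m i := by
  have hq0 : 0 < q := by positivity
  refine div_pos (Real.rpow_pos_of_pos hq0 _) (mul_pos ?_ ?_) <;>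
    refine Finset.prod_pos fun j _ => one_sub_rpow_pos hq ?_ <;>
    linarith [j.cast_nonneg (α := ℝ)]

lemma piWt_succ {q m : ℝ} (hq : 1 < q) (i : ℕ) :
    piWt q m (i + 1) = piWt q m i * (q ^ (-(2 * (i : ℝ) + 1 + m)) /
      ((1 - q ^ (-((i : ℝ) + 1))) * (1 - q ^ (-m - ((i : ℝ) + 1))))) := by
  have h : q ^ (-(((i + 1 : ℕ) : ℝ) * (((i + 1 : ℕ) : ℝ) + m))) =
      q ^ (-((i : ℝ) * ((i : ℝ) + m))) * q ^ (-(2 * (i : ℝ) + 1 + m)) := by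
    rw [← Real.rpow_add (by positivity)]
    congr 1
    push_cast
    ring
  rw [piWt, piWt, h, Finset.prod_range_succ, Finset.prod_range_succ, div_mul_div_comm]
  congr 1
  ring

lemma summable_piWt_mul_sq {q m : ℝ} (hq : 1 < q) (hm : -1 < m) :
    Summable fun i : ℕ => piWt q m i * eulerSum q (-q ^ i) ^ 2 := by
  have hq0 : 0 < q := by positivity
  have hw := piWt_pos hq hm
  have hG (i : ℕ) : 0 < eulerSum q (-q ^ i) :=
    zero_lt_one.trans_le (one_le_eulerSum_neg hq (by positivity))
  have hlt : q ^ (-(1 + m)) < 1 := Real.rpow_lt_one_of_one_lt_of_neg hq (by linarith)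
  refine summable_of_ratio_test_tendsto_lt_one hlt
    (Eventually.of_forall fun i => (mul_pos (hw i) (pow_pos (hG i) 2)).ne') ?_
  have hpow (c : ℝ) : Tendsto (fun i : ℕ => q ^ (c - (i : ℝ))) atTop (𝓝 0) := by
    have h := (tendsto_pow_atTop_nhds_zero_of_lt_one (inv_nonneg.2 hq0.le)
      (inv_lt_one_of_one_lt₀ hq)).const_mul (q ^ c)
    rw [mul_zero] at h
    refine h.congr fun i => ?_
    rw [Real.rpow_sub hq0, Real.rpow_natCast, inv_pow, div_eq_mul_inv]
  have hlim : Tendsto (fun i : ℕ => q ^ (-(1 + m)) * (q ^ (0 - (i : ℝ)) + 1) ^ 2 /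
      ((1 - q ^ (-1 - (i : ℝ))) * (1 - q ^ (-m - 1 - (i : ℝ))))) atTop
      (𝓝 (q ^ (-(1 + m)) * (0 + 1) ^ 2 / ((1 - 0) * (1 - 0)))) :=
    ((((hpow 0).add_const 1).pow 2).const_mul _).div
      (((hpow _).const_sub 1).mul ((hpow _).const_sub 1)) (by norm_num)
  simp only [zero_add, one_pow, sub_zero, mul_one, div_one] at hlim
  refine hlim.congr fun i => ?_
  have hGs : eulerSum q (-q ^ (i + 1)) = (1 + q ^ i) * eulerSum q (-q ^ i) := by
    rw [pow_succ', ← mul_neg, eulerSum_mul_left hq, sub_neg_eq_add]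
  have hexp : q ^ (-(2 * (i : ℝ) + 1 + m)) = q ^ (-(1 + m)) * (q ^ (0 - (i : ℝ))) ^ 2 := by
    rw [← Real.rpow_mul_natCast hq0.le, ← Real.rpow_add hq0]
    congr 1
    push_cast
    ring
  have hinv : q ^ (0 - (i : ℝ)) * q ^ i = 1 := by
    rw [← Real.rpow_natCast q i, ← Real.rpow_add hq0]
    simp
  rw [Real.norm_of_nonneg (mul_pos (hw _) (pow_pos (hG _) 2)).le,
    Real.norm_of_nonneg (mul_pos (hw _) (pow_pos (hG _) 2)).le, piWt_succ hq, hGs, hexp,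
    show -((i : ℝ) + 1) = -1 - i by ring, show -m - ((i : ℝ) + 1) = -m - 1 - i by ring,
    eq_div_iff (mul_pos (hw _) (pow_pos (hG _) 2)).ne',
    show q ^ (0 - (i : ℝ)) + 1 = q ^ (0 - (i : ℝ)) * (1 + q ^ i) by
      linear_combination -hinv]
  ring

lemma tsum_piWt_pos {q m : ℝ} (hq : 1 < q) (hm : -1 < m) : 0 < ∑' k, piWt q m k := by
  have hw := piWt_pos hq hm
  refine Summable.tsum_pos ?_ (fun i => (hw i).le) 0 (hw 0)
  refine (summable_piWt_mul_sq hq hm).of_nonneg_of_le (fun i => (hw i).le) fun i => ?_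
  exact le_mul_of_one_le_right (hw i).le
    (one_le_pow₀ (one_le_eulerSum_neg hq (by positivity)))

lemma sum_cCoef_mul_piM {q m : ℝ} (hq : 1 < q) (hm : -1 < m) (n i : ℕ) :
    ∑ k ∈ Finset.range n, cCoef q m k * piM q m i * q ^ ((k : ℝ) * (i : ℝ)) =
      piWt q m i / etaInf q * ∑ k ∈ Finset.range n, bCoef q k * (q ^ i) ^ k := by
  have hZ := (tsum_piWt_pos hq hm).ne'
  have hη := etaInf_ne_zero hq
  rw [Finset.mul_sum]
  refine Finset.sum_congr rfl fun k _ => ?_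
  rw [mul_comm (k : ℝ), Real.rpow_mul_natCast (by positivity), Real.rpow_natCast, cCoef, piM, piM,
    piWt_zero]
  field_simp

/-- The partial sums `Σ_{k=0}^{N} c_k·(π_m ∘ q^k)` converge to `δ₀`
in `ℓ²(π_m)`. -/
theorem stmt9 (q m : ℝ) (hq : 1 < q) (hm : -1 < m) :
    Filter.Tendsto
      (fun N : ℕ => ∑' i : ℕ, (piM q m i)⁻¹ *
        |(∑ k ∈ Finset.range (N + 1), cCoef q m k * piM q m i * q ^ ((k : ℝ) * (i : ℝ)))
            - (if i = 0 then 1 else 0)| ^ 2)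
      Filter.atTop (nhds 0) := by
  have hw := piWt_pos hq hm
  have hZ := tsum_piWt_pos hq hm
  have hη := etaInf_ne_zero hq
  set Z := ∑' k, piWt q m k
  simp_rw [sum_cCoef_mul_piM hq hm]
  rw [show 𝓝 (0 : ℝ) = 𝓝 (∑' _ : ℕ, (0 : ℝ)) by rw [tsum_zero]]
  refine tendsto_tsum_of_dominated_convergence
    ((summable_piWt_mul_sq hq hm).mul_left (Z * (|etaInf q|⁻¹ + 1) ^ 2))
    (fun i => ?_) (Eventually.of_forall fun N i => ?_)
  · have hlim : Tendsto (fun N : ℕ => ∑ k ∈ Finset.range (N + 1), bCoef q k * (q ^ i) ^ k)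
        atTop (𝓝 (eulerSum q (q ^ i))) :=
      (summable_bCoef_mul_pow hq _).tendsto_sum_tsum_nat.comp (tendsto_add_atTop_nat 1)
    have hval : piWt q m i / etaInf q * eulerSum q (q ^ i) - (if i = 0 then 1 else 0) = 0 := by
      cases i with
      | zero => simp [eulerSum_one hq, piWt_zero, hη]
      | succ i => simp [eulerSum_pow_succ hq]
    have h := ((((hlim.const_mul (piWt q m i / etaInf q)).sub_const
      (if i = 0 then 1 else 0)).abs.pow 2).const_mul (piM q m i)⁻¹)
    simpa only [hval, abs_zero, ne_eq, OfNat.ofNat_ne_zero, not_false_eq_true, zero_pow,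
      mul_zero] using h
  · set S := ∑ k ∈ Finset.range (N + 1), bCoef q k * (q ^ i) ^ k
    set G := eulerSum q (-q ^ i)
    have hS : |S| ≤ G := abs_partialSum_le hq (by positivity) _
    have hG : 1 ≤ G := one_le_eulerSum_neg hq (by positivity)
    have hδ : |if i = 0 then (1 : ℝ) else 0| ≤ piWt q m i := by
      split_ifs with hi
      · rw [hi, piWt_zero, abs_one]
      · simpa using (hw i).le
    have hbound : |piWt q m i / etaInf q * S - (if i = 0 then 1 else 0)| ≤
        piWt q m i * ((|etaInf q|⁻¹ + 1) * G) := by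
      calc _ ≤ |piWt q m i / etaInf q * S| + |if i = 0 then (1 : ℝ) else 0| := abs_sub _ _
        _ ≤ piWt q m i / |etaInf q| * G + piWt q m i * G := by
          rw [abs_mul, abs_div, abs_of_pos (hw i)]
          have := hw i
          gcongr
          exact hδ.trans (le_mul_of_one_le_right (hw i).le hG)
        _ = _ := by ring
    have hpi : (piM q m i)⁻¹ = Z * (piWt q m i)⁻¹ := by rw [piM, mul_inv, inv_inv]
    have hwi := hw i
    rw [hpi, Real.norm_of_nonneg (by positivity)]
    calc _ ≤ Z * (piWt q m i)⁻¹ * (piWt q m i * ((|etaInf q|⁻¹ + 1) * G)) ^ 2 := by gcongr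
      _ = _ := by field_simp
end
end

section
/- For every prime power q, the operator μ ↦ μP_sym on ℓ²(π_sym) is Hilbert–Schmidt (in particular compact) and self-adjoint, and its set of eigenvalues is exactly {q^{−k} : k ≥ 0} ∪ {−q^{−k} : k ≥ 1}, i.e. {±q^{−k} : k ≥ 0} with −1 removed. -/
noncomputable section

open scoped ENNReal

/-- The tridiagonal transition matrix `P_sym` for the symmetric-matrix Markov chain. -/
def Psym (q : ℝ) (i j : ℕ) : ℝ :=
  if j = i + 1 then q⁻¹ ^ (i + 1)
  else if j = i then q⁻¹ ^ i - q⁻¹ ^ (i + 1)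
  else if i = j + 1 then 1 - q⁻¹ ^ i
  else 0

/-- `α(q) = ∏_{i ≥ 1, i odd} (1 − q^{-i})`. -/
def alphaQ (q : ℝ) : ℝ := ∏' i : ℕ, (1 - q⁻¹ ^ (2 * i + 1))

/-- The stationary distribution `π_sym(k) = α(q)/∏_{i=1}^{k}(q^i − 1)`. -/
def piSym (q : ℝ) (k : ℕ) : ℝ := alphaQ q / ∏ i ∈ Finset.range k, (q ^ (i + 1) - 1)

open Filter Topology
open scoped InnerProductSpace

/-- The Hilbert space `ℓ²(ℕ, ℂ)`. -/
local notation "ℓ₂" => lp (fun _ : ℕ => ℂ) 2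

theorem HasSum.of_eq_single {M : Type*} [AddCommMonoid M] [TopologicalSpace M] {f : ℕ → M}
    {c : M} (j : ℕ) (h : ∀ k, k ≠ j → f k = 0) (hc : f j = c) : HasSum f c :=
  hc ▸ hasSum_single j h

theorem lp_hasSum_norm_sq (f : ℓ₂) : HasSum (fun i => ‖f i‖ ^ 2) (‖f‖ ^ 2) := by
  have h := lp.hasSum_norm (p := 2) (by norm_num) f
  simpa using h

/-- The Hilbert–Schmidt bound: for a symmetric operator on `ℓ²`, the squared eigenvalues (without
multiplicity) sum to at most the squared Hilbert–Schmidt norm. -/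
theorem sum_sq_eigenvalues_le {T : ℓ₂ →L[ℂ] ℓ₂} (hT : (T : ℓ₂ →ₗ[ℂ] ℓ₂).IsSymmetric) {H : ℝ}
    (hH : HasSum (fun k : ℕ => ‖T (lp.single 2 k 1)‖ ^ 2) H) (F : Finset ℂ)
    (hF : ∀ μ ∈ F, Module.End.HasEigenvalue (T : ℓ₂ →ₗ[ℂ] ℓ₂) μ) :
    ∑ μ ∈ F, ‖μ‖ ^ 2 ≤ H := by
  have hv : ∀ μ : F, ∃ v : ℓ₂, ‖v‖ = 1 ∧ T v = (μ : ℂ) • v := by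
    rintro ⟨μ, hμ⟩
    obtain ⟨v, hv⟩ := (hF μ hμ).exists_hasEigenvector
    have hv0 : ‖v‖ ≠ 0 := norm_ne_zero_iff.2 hv.2
    refine ⟨((‖v‖ : ℂ)⁻¹) • v, by simp [norm_smul, hv0], ?_⟩
    have := hv.apply_eq_smul
    simp only [ContinuousLinearMap.coe_coe] at this
    rw [map_smul, this, smul_comm]
  choose v hv1 hvT using hv
  have hortho : Orthonormal ℂ v := by
    refine ⟨hv1, fun μ ν hne => ?_⟩
    have h := hT.orthogonalFamily_eigenspaces (Subtype.coe_injective.ne hne)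
      ⟨v μ, Module.End.mem_eigenspace_iff.2 (hvT μ)⟩ ⟨v ν, Module.End.mem_eigenspace_iff.2 (hvT ν)⟩
    simpa using h
  have hcoord : ∀ μ : F, HasSum (fun k : ℕ => ‖⟪v μ, T (lp.single 2 k 1)⟫_ℂ‖ ^ 2) (‖(μ : ℂ)‖ ^ 2) := by
    intro μ
    have h := lp_hasSum_norm_sq (T (v μ))
    rw [hvT μ, norm_smul, hv1, mul_one] at h
    refine h.congr_fun ?_
    intro k
    have := hT (v μ) (lp.single 2 k 1)
    simp only [ContinuousLinearMap.coe_coe] at this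
    rw [← this, lp.inner_single_right, hvT μ]
    simp
  have hsum := hasSum_sum (s := Finset.univ) fun μ (_ : μ ∈ Finset.univ) => hcoord μ
  rw [← Finset.sum_coe_sort F fun μ => ‖μ‖ ^ 2]
  exact hasSum_le (fun k => hortho.sum_inner_products_le _) hsum hH

section Jacobi

variable (a β : ℕ → ℝ)

/-- The `k`-th column of the Jacobi matrix with diagonal `a` and off-diagonal entries
`β (k + 1)` in positions `(k, k + 1)` and `(k + 1, k)`; it is assumed that `β 0 = 0`. -/
def jacobiCol (k : ℕ) : ℓ₂ :=
  lp.single 2 k (a k : ℂ) + lp.single 2 (k + 1) (β (k + 1) : ℂ) + lp.single 2 (k - 1) (β k : ℂ)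

/-- The Jacobi operator as a series of rank-one operators. -/
def jacobi : ℓ₂ →L[ℂ] ℓ₂ :=
  ∑' k, (innerSL ℂ (lp.single 2 k 1 : ℓ₂)).smulRight (jacobiCol a β k)

variable {a β}

theorem norm_jacobiCol_le (k : ℕ) : ‖jacobiCol a β k‖ ≤ |a k| + |β (k + 1)| + |β k| := by
  refine (norm_add₃_le).trans ?_
  simp [lp.norm_single]

theorem summable_jacobi (ha : Summable fun k => |a k|) (hβ : Summable fun k => |β k|) :
    Summable fun k => (innerSL ℂ (lp.single 2 k 1 : ℓ₂)).smulRight (jacobiCol a β k) := by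
  refine Summable.of_norm_bounded ((ha.add ((summable_nat_add_iff 1).2 hβ)).add hβ) fun k => ?_
  rw [ContinuousLinearMap.norm_smulRight_apply, innerSL_apply_norm, lp.norm_single (by norm_num)]
  simpa using norm_jacobiCol_le k

theorem hasSum_jacobi_apply (ha : Summable fun k => |a k|) (hβ : Summable fun k => |β k|)
    (f : ℓ₂) : HasSum (fun k => f k • jacobiCol a β k) (jacobi a β f) := by
  have h := (summable_jacobi ha hβ).hasSum.mapL (ContinuousLinearMap.apply ℂ ℓ₂ f)
  refine h.congr_fun fun k => ?_
  simp [lp.inner_single_left]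

theorem hasSum_jacobi_apply_coord (ha : Summable fun k => |a k|) (hβ : Summable fun k => |β k|)
    (f : ℓ₂) (j : ℕ) : HasSum (fun k => f k * jacobiCol a β k j) (jacobi a β f j) := by
  exact (hasSum_jacobi_apply ha hβ f).mapL (lp.evalCLM ℂ (fun _ : ℕ => ℂ) 2 j)

theorem jacobi_apply (h0 : β 0 = 0) (ha : Summable fun k => |a k|)
    (hβ : Summable fun k => |β k|) (f : ℓ₂) (j : ℕ) :
    jacobi a β f j = a j * f j + β j * f (j - 1) + β (j + 1) * f (j + 1) := by
  refine (hasSum_jacobi_apply_coord ha hβ f j).unique ?_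
  have h1 : HasSum (fun k => f k * (lp.single 2 k (a k : ℂ) : ℓ₂) j) (a j * f j) := by
    refine .of_eq_single j (fun k hk => ?_) (by simp [mul_comm])
    rw [lp.single_apply_ne _ _ _ hk.symm, mul_zero]
  have h2 : HasSum (fun k => f k * (lp.single 2 (k + 1) (β (k + 1) : ℂ) : ℓ₂) j)
      (β j * f (j - 1)) := by
    refine .of_eq_single (j - 1) (fun k hk => ?_) ?_
    · rw [lp.single_apply_ne _ _ _ (by omega), mul_zero]
    · rcases j with _ | j
      · simp [h0]
      · simp [mul_comm]
  have h3 : HasSum (fun k => f k * (lp.single 2 (k - 1) (β k : ℂ) : ℓ₂) j)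
      (β (j + 1) * f (j + 1)) := by
    refine .of_eq_single (j + 1) (fun k hk => ?_) (by simp [mul_comm])
    rcases k with _ | k
    · simp [h0]
    · rw [lp.single_apply_ne _ _ _ (by omega), mul_zero]
  refine ((h1.add h2).add h3).congr_fun fun k => ?_
  simp only [jacobiCol, lp.coeFn_add, Pi.add_apply]
  ring

theorem jacobi_single (ha : Summable fun k => |a k|) (hβ : Summable fun k => |β k|) (k : ℕ) :
    jacobi a β (lp.single 2 k 1) = jacobiCol a β k := by
  refine (hasSum_jacobi_apply ha hβ _).unique ?_
  refine .of_eq_single k (fun j hj => ?_) (by simp)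
  rw [lp.single_apply_ne _ _ _ hj, zero_smul]

theorem inner_jacobiCol (h0 : β 0 = 0) (ha : Summable fun k => |a k|)
    (hβ : Summable fun k => |β k|) (k : ℕ) (g : ℓ₂) :
    ⟪jacobiCol a β k, g⟫_ℂ = jacobi a β g k := by
  rw [jacobi_apply h0 ha hβ]
  simp only [jacobiCol, inner_add_left, lp.inner_single_left]
  simp
  ring

theorem isSymmetric_jacobi (h0 : β 0 = 0) (ha : Summable fun k => |a k|)
    (hβ : Summable fun k => |β k|) : (jacobi a β : ℓ₂ →ₗ[ℂ] ℓ₂).IsSymmetric := by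
  intro f g
  have h1 := (hasSum_jacobi_apply ha hβ f).mapL ((innerSL ℂ).flip g)
  refine h1.unique ?_
  refine (lp.hasSum_inner f (jacobi a β g)).congr_fun fun k => ?_
  simp [inner_jacobiCol h0 ha hβ, mul_comm]

theorem isCompactOperator_jacobi (ha : Summable fun k => |a k|) (hβ : Summable fun k => |β k|) :
    IsCompactOperator (jacobi a β) := by
  refine isCompactOperator_of_tendsto (summable_jacobi ha hβ).hasSum (Eventually.of_forall ?_)
  intro s
  refine (compactOperator (RingHom.id ℂ) ℓ₂ ℓ₂).sum_mem fun k _ => ?_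
  have hid : IsCompactOperator (id : ℂ → ℂ) :=
    (isCompactOperator_id_iff_finiteDimensional (𝕜 := ℂ)).2 inferInstance
  exact (hid.comp_clm (innerSL ℂ (lp.single 2 k 1 : ℓ₂))).clm_comp
    (ContinuousLinearMap.toSpanSingleton ℂ (jacobiCol a β k))

theorem norm_sq_jacobiCol (h0 : β 0 = 0) (k : ℕ) :
    ‖jacobiCol a β k‖ ^ 2 = a k ^ 2 + β k ^ 2 + β (k + 1) ^ 2 := by
  rw [← RCLike.ofReal_inj (K := ℂ)]
  push_cast
  rw [← inner_self_eq_norm_sq_to_K (𝕜 := ℂ)]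
  nth_rw 1 [jacobiCol]
  simp only [inner_add_left, lp.inner_single_left, jacobiCol, lp.coeFn_add, Pi.add_apply,
    lp.single_apply]
  rcases k with _ | k
  · simp [h0, ← Complex.ofReal_pow]
  · have h1 : k + 1 + 1 ≠ k := by omega
    simp [h1, h1.symm, ← Complex.ofReal_pow]
    ring

end Jacobi

/-- A lower-triangular chain `A u₀ = l₀ u₀`, `A uₘ₊₁ = lₘ₊₁ uₘ₊₁ + dₘ uₘ` with distinct diagonal
entries yields, for each `k`, an eigenvector for `l k` with leading term `u k`. -/
theorem exists_eigenvector_of_triangular {K E : Type*} [Field K] [AddCommGroup E] [Module K E]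
    (A : E →ₗ[K] E) (u : ℕ → E) (l d : ℕ → K) (hl : Function.Injective l)
    (hu0 : A (u 0) = l 0 • u 0) (hu : ∀ m, A (u (m + 1)) = l (m + 1) • u (m + 1) + d m • u m)
    (k : ℕ) :
    ∃ c : ℕ → K, c k = 1 ∧
      A (∑ m ∈ Finset.range (k + 1), c m • u m)
        = l k • ∑ m ∈ Finset.range (k + 1), c m • u m := by
  let c : ℕ → K := fun m => ∏ r ∈ Finset.Ico m k, d r / (l k - l r)
  have hc : ∀ m ∈ Finset.range k, c m * (l k - l m) = d m * c (m + 1) := by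
    intro m hm
    have hm := Finset.mem_range.1 hm
    have hne : l k - l m ≠ 0 := sub_ne_zero.2 (hl.ne hm.ne')
    simp only [c]
    rw [Finset.prod_eq_prod_Ico_succ_bot hm]
    field_simp
  have hck : c k = 1 := by simp [c]
  refine ⟨c, hck, ?_⟩
  have h1 : A (∑ m ∈ Finset.range (k + 1), c m • u m)
      = ∑ m ∈ Finset.range (k + 1), (c m * l m) • u m
        + ∑ m ∈ Finset.range k, (d m * c (m + 1)) • u m := by
    rw [map_sum, Finset.sum_range_succ', Finset.sum_range_succ' (fun m => (c m * l m) • u m)]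
    simp only [map_smul, hu, hu0, smul_add, smul_smul, Finset.sum_add_distrib, mul_comm (d _)]
    abel
  rw [h1, Finset.sum_range_succ, Finset.sum_range_succ, smul_add, add_right_comm,
    ← Finset.sum_add_distrib, Finset.smul_sum, hck, one_mul, one_smul]
  congr 1
  refine Finset.sum_congr rfl fun m hm => ?_
  rw [← hc m hm, ← add_smul, smul_smul]
  congr 1
  ring

section Psym

/-- Diagonal entries of the symmetrized matrix `P_sym`. -/
def psymDiag (q : ℝ) (k : ℕ) : ℝ := q⁻¹ ^ k * (1 - q⁻¹)

/-- Off-diagonal entries of the symmetrized matrix `P_sym`. -/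
def psymOff (q : ℝ) (k : ℕ) : ℝ := q⁻¹ ^ k * √(q ^ k - 1)

/-- The operator `μ ↦ μ P_sym`, transported to the standard `ℓ²(ℕ, ℂ)`. -/
def psymOp (q : ℝ) : ℓ₂ →L[ℂ] ℓ₂ := jacobi (psymDiag q) (psymOff q)

/-- The weight `√(π_sym(k) / π_sym(0))`. -/
def psymWeight (q : ℝ) (k : ℕ) : ℝ := ∏ r ∈ Finset.range k, (√(q ^ (r + 1) - 1))⁻¹

variable {q : ℝ}

@[simp]
theorem psymOff_zero : psymOff q 0 = 0 := by simp [psymOff]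

theorem pow_succ_sub_one_pos (hq : 1 < q) (k : ℕ) : 0 < q ^ (k + 1) - 1 :=
  sub_pos.2 (one_lt_pow₀ hq k.succ_ne_zero)

theorem sq_sqrt_pow_sub_one (hq : 1 < q) (k : ℕ) : √(q ^ k - 1) ^ 2 = q ^ k - 1 :=
  Real.sq_sqrt (sub_nonneg.2 (one_le_pow₀ hq.le))

theorem summable_psymDiag (hq : 1 < q) : Summable fun k => |psymDiag q k| := by
  refine ((summable_geometric_of_lt_one (by positivity) (inv_lt_one_of_one_lt₀ hq)).mul_right
    (1 - q⁻¹)).abs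

theorem summable_psymOff (hq : 1 < q) : Summable fun k => |psymOff q k| := by
  have hq0 : 0 < q := by linarith
  have hs : 1 < √q := Real.lt_sqrt_of_sq_lt (by simpa)
  refine Summable.of_nonneg_of_le (fun _ => abs_nonneg _) (fun k => ?_)
    (summable_geometric_of_lt_one (by positivity) (inv_lt_one_of_one_lt₀ hs))
  rw [psymOff, abs_of_nonneg (by positivity)]
  calc q⁻¹ ^ k * √(q ^ k - 1) ≤ q⁻¹ ^ k * √(q ^ k) := by gcongr; linarith
    _ = (√q)⁻¹ ^ k := by
      rw [Real.sqrt_eq_rpow, ← Real.rpow_natCast_mul hq0.le, mul_comm (k : ℝ),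
        Real.rpow_mul_natCast hq0.le, ← Real.sqrt_eq_rpow, ← mul_pow]
      congr 1
      field_simp
      exact Real.sq_sqrt hq0.le

theorem psymOp_apply (hq : 1 < q) (f : ℓ₂) (j : ℕ) :
    psymOp q f j = psymDiag q j * f j + psymOff q j * f (j - 1) + psymOff q (j + 1) * f (j + 1) :=
  jacobi_apply psymOff_zero (summable_psymDiag hq) (summable_psymOff hq) f j

theorem hasSum_norm_sq_psymOp_single (hq : 1 < q) :
    HasSum (fun k : ℕ => ‖psymOp q (lp.single 2 k 1)‖ ^ 2)
      ((1 + q⁻¹ ^ 2) / (1 - q⁻¹ ^ 2)) := by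
  have ht0 : 0 < q⁻¹ := inv_pos.2 (by linarith)
  have ht1 : q⁻¹ < 1 := inv_lt_one_of_one_lt₀ hq
  have h1 := hasSum_geometric_of_lt_one ht0.le ht1
  have h2 := hasSum_geometric_of_lt_one (r := q⁻¹ ^ 2) (by positivity) (by nlinarith)
  have hoff : ∀ k, psymOff q k ^ 2 = q⁻¹ ^ k - (q⁻¹ ^ 2) ^ k := fun k => by
    have : q ^ k ≠ 0 := by positivity
    rw [psymOff, mul_pow, sq_sqrt_pow_sub_one hq]
    simp only [inv_pow]
    field_simp
    ring
  have hne1 : 1 - q⁻¹ ≠ 0 := by linarith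
  have hne2 : 1 + q⁻¹ ≠ 0 := by linarith
  have hne : 1 - q⁻¹ ^ 2 ≠ 0 := by
    rw [show 1 - q⁻¹ ^ 2 = (1 - q⁻¹) * (1 + q⁻¹) by ring]
    exact mul_ne_zero hne1 hne2
  convert! ((h2.mul_left ((1 - q⁻¹) ^ 2)).add (h1.sub h2)).add
    ((h1.mul_left q⁻¹).sub (h2.mul_left (q⁻¹ ^ 2))) using 1
  · funext k
    rw [psymOp, jacobi_single (summable_psymDiag hq) (summable_psymOff hq),
      norm_sq_jacobiCol psymOff_zero, hoff, hoff, psymDiag]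
    ring
  · generalize q⁻¹ = t at *
    field_simp
    ring

theorem tendsto_coord_zero (f : ℓ₂) : Tendsto (fun i => ‖f i‖) atTop (𝓝 0) := by
  have h := (lp_hasSum_norm_sq f).summable.tendsto_atTop_zero.sqrt
  simpa using h

theorem psymOp_injective (hq : 1 < q) {v : ℓ₂} (hv : psymOp q v = 0) : v = 0 := by
  have hq0 : q ≠ 0 := by linarith
  set s : ℕ → ℝ := fun k => √(q ^ k - 1) with hs
  have hs0 : ∀ k, s (k + 1) ≠ 0 := fun k => (Real.sqrt_pos.2 (pow_succ_sub_one_pos hq k)).ne'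
  have hs2 : ∀ k, (s k : ℂ) ^ 2 = q ^ k - 1 := fun k => by
    exact_mod_cast sq_sqrt_pow_sub_one hq k
  have hqC : (q : ℂ) ≠ 0 := by exact_mod_cast hq0
  have hrec : ∀ j, (q - 1) * v j + q * s j * v (j - 1) + s (j + 1) * v (j + 1) = 0 := fun j => by
    have h := psymOp_apply hq v j
    rw [hv, psymDiag, psymOff, psymOff] at h
    have h' : (0 : ℂ) = (q : ℂ)⁻¹ ^ j * (1 - (q : ℂ)⁻¹) * v j + (q : ℂ)⁻¹ ^ j * s j * v (j - 1)
        + (q : ℂ)⁻¹ ^ (j + 1) * s (j + 1) * v (j + 1) := by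
      simpa using h
    have h'' := congrArg (fun x : ℂ => q ^ (j + 1) * x) h'
    have h1 : (q : ℂ) ^ j * (q : ℂ)⁻¹ ^ j = 1 := by
      rw [← mul_pow, mul_inv_cancel₀ hqC, one_pow]
    have h2 : (q : ℂ) * (q : ℂ)⁻¹ = 1 := mul_inv_cancel₀ hqC
    simp only [pow_succ _ j] at h''
    linear_combination -h'' - (q * (1 - (q : ℂ)⁻¹) * v j + q * s j * v (j - 1)
      + q * (q : ℂ)⁻¹ * s (j + 1) * v (j + 1)) * h1 + (v j - s (j + 1) * v (j + 1)) * h2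
  have hstep : ∀ m, v (2 * m + 1) = -s (2 * m + 1) * v (2 * m) →
      s (2 * m + 2) * v (2 * m + 2) = v (2 * m + 1) := fun m h => by
    have h1 := hrec (2 * m + 1)
    simp only [Nat.add_sub_cancel] at h1
    have : (s (2 * m + 1 + 1) : ℂ) * v (2 * m + 1 + 1) = v (2 * m + 1) := by
      linear_combination h1 - q * h
    exact this
  have hodd : ∀ m, v (2 * m + 1) = -s (2 * m + 1) * v (2 * m) := fun m => by
    induction m with
    | zero =>
      have h1 := hrec 0
      have h2 := hs2 1
      have h0 : s 0 = 0 := by simp [hs]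
      have h3 : (s 1 : ℂ) ≠ 0 := by exact_mod_cast hs0 0
      simp only [h0] at h1
      refine mul_left_cancel₀ h3 ?_
      simp at h1 h2 ⊢
      linear_combination h1 + h2 * v 0
    | succ m ih =>
      have h1 := hrec (2 * m + 2)
      have h2 := hs2 (2 * m + 2)
      have h3 := hs2 (2 * m + 3)
      have h4 := hstep m ih
      have h5 : (s (2 * m + 3) : ℂ) ≠ 0 := by exact_mod_cast hs0 (2 * m + 2)
      rw [show 2 * (m + 1) = 2 * m + 2 by ring]
      simp only [show 2 * m + 2 - 1 = 2 * m + 1 by omega,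
        show 2 * m + 2 + 1 = 2 * m + 3 by omega] at h1 ⊢
      refine mul_left_cancel₀ h5 ?_
      linear_combination h1 + q * s (2 * m + 2) * h4 - q * v (2 * m + 2) * h2 + v (2 * m + 2) * h3
  have heven := fun m => hstep m (hodd m)
  have hmono : Monotone fun m => ‖v (2 * m + 1)‖ := monotone_nat_of_le_succ fun m => by
    rw [hodd (m + 1), ← heven m, show 2 * (m + 1) = 2 * m + 2 by ring]
    have : s (2 * m + 2) ≤ s (2 * m + 2 + 1) :=
      Real.sqrt_le_sqrt (sub_le_sub_right (pow_le_pow_right₀ hq.le (Nat.le_succ _)) _)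
    simp only [norm_mul, norm_neg, Complex.norm_real, Real.norm_eq_abs]
    rw [abs_of_nonneg (Real.sqrt_nonneg _), abs_of_nonneg (Real.sqrt_nonneg _)]
    gcongr
  have hodd0 : ∀ m, v (2 * m + 1) = 0 := fun m => by
    have ht : Tendsto (fun m : ℕ => ‖v (2 * m + 1)‖) atTop (𝓝 0) :=
      (tendsto_coord_zero v).comp (tendsto_atTop_mono (fun m => (by omega : m ≤ 2 * m + 1)) tendsto_id)
    exact norm_le_zero_iff.1 (hmono.ge_of_tendsto ht m)
  ext i
  rcases Nat.even_or_odd' i with ⟨m, rfl | rfl⟩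
  · have h := hodd m
    rw [hodd0, eq_comm, mul_eq_zero, neg_eq_zero] at h
    exact h.resolve_left (Complex.ofReal_ne_zero.2 (hs0 (2 * m)))
  · exact hodd0 m

theorem psymWeight_ne_zero (hq : 1 < q) (k : ℕ) : psymWeight q k ≠ 0 :=
  Finset.prod_ne_zero_iff.2 fun r _ =>
    inv_ne_zero (Real.sqrt_pos.2 (pow_succ_sub_one_pos hq r)).ne'

theorem psymWeight_succ_mul (hq : 1 < q) (k : ℕ) :
    psymWeight q (k + 1) * √(q ^ (k + 1) - 1) = psymWeight q k := by
  rw [psymWeight, Finset.prod_range_succ, mul_assoc,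
    inv_mul_cancel₀ (Real.sqrt_pos.2 (pow_succ_sub_one_pos hq k)).ne', mul_one, psymWeight]

theorem memℓp_pow_mul_psymWeight (hq : 1 < q) {z : ℂ} (hz : z ≠ 0) :
    Memℓp (fun i : ℕ => z ^ i * (psymWeight q i : ℂ)) 2 := by
  refine Memℓp.of_exponent_ge (q := 1) (memℓp_gen ?_) (by norm_num)
  simp only [ENNReal.toReal_one, Real.rpow_one]
  refine summable_of_ratio_test_tendsto_lt_one (l := 0) one_pos (Eventually.of_forall fun i => ?_) ?_
  · simp [hz, psymWeight_ne_zero hq]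
  · have h1 : Tendsto (fun i : ℕ => √(q ^ (i + 1) - 1)) atTop atTop :=
      Real.tendsto_sqrt_atTop.comp (tendsto_atTop_add_const_right _ (-1)
        ((tendsto_pow_atTop_atTop_of_one_lt hq).comp (tendsto_add_atTop_nat 1)))
    refine (h1.const_div_atTop ‖z‖).congr fun i => ?_
    have h2 := psymWeight_ne_zero hq (i + 1)
    have h3 := (Real.sqrt_pos.2 (pow_succ_sub_one_pos hq i)).ne'
    have hz' := norm_ne_zero_iff.2 hz
    have h4 := abs_ne_zero.2 h2
    rw [norm_norm, norm_norm, norm_mul, norm_mul, norm_pow, norm_pow, Complex.norm_real,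
      Complex.norm_real, Real.norm_eq_abs, Real.norm_eq_abs, ← psymWeight_succ_mul hq i, abs_mul,
      abs_of_nonneg (Real.sqrt_nonneg _), pow_succ ‖z‖]
    field_simp

/-- The geometric vector `i ↦ zⁱ √(π_sym(i) / π_sym(0))`. -/
def psymGeom (hq : 1 < q) {z : ℂ} (hz : z ≠ 0) : ℓ₂ := ⟨_, memℓp_pow_mul_psymWeight hq hz⟩

theorem psymGeom_apply (hq : 1 < q) {z : ℂ} (hz : z ≠ 0) (i : ℕ) :
    psymGeom hq hz i = z ^ i * psymWeight q i := rfl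

theorem psymOp_psymGeom_apply (hq : 1 < q) {z : ℂ} (hz : z ≠ 0) (i : ℕ) :
    psymOp q (psymGeom hq hz) i
      = z⁻¹ * psymGeom hq hz i
        + (1 - (q : ℂ)⁻¹ - z⁻¹ + (q : ℂ)⁻¹ * z) * (((q : ℂ)⁻¹ * z) ^ i * psymWeight q i) := by
  have hqC : (q : ℂ) ≠ 0 := by exact_mod_cast (by linarith : q ≠ 0)
  rw [psymOp_apply hq]
  simp only [psymGeom_apply, psymDiag, psymOff]
  have h1 : (psymWeight q (i + 1) : ℂ) * (√(q ^ (i + 1) - 1) : ℝ) = psymWeight q i := by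
    exact_mod_cast psymWeight_succ_mul hq i
  have h2 : ((√(q ^ i - 1) : ℝ) : ℂ) * (z ^ (i - 1) * psymWeight q (i - 1))
      = (q ^ i - 1) * z⁻¹ * z ^ i * psymWeight q i := by
    rcases i with _ | i
    · simp
    · have h3 : (psymWeight q (i + 1) : ℂ) * (√(q ^ (i + 1) - 1) : ℝ) = psymWeight q i := by
        exact_mod_cast psymWeight_succ_mul hq i
      have h4 : ((√(q ^ (i + 1) - 1) : ℝ) : ℂ) ^ 2 = q ^ (i + 1) - 1 := by
        exact_mod_cast sq_sqrt_pow_sub_one hq (i + 1)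
      rw [Nat.add_sub_cancel, ← h3, ← h4, pow_succ z]
      field_simp
  push_cast
  rw [mul_assoc _ _ (z ^ (i - 1) * _), h2]
  have h5 : ((q : ℂ)⁻¹) ^ i * q ^ i = 1 := by rw [← mul_pow, inv_mul_cancel₀ hqC, one_pow]
  rw [mul_pow, pow_succ (q : ℂ)⁻¹, pow_succ z]
  linear_combination (q : ℂ)⁻¹ ^ i * (q : ℂ)⁻¹ * z ^ i * z * h1
    + z⁻¹ * z ^ i * psymWeight q i * h5

/-- If `z₀` is one of the two points `1`, `-q` where the chain of geometric vectors terminates,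
then every `z₀⁻¹ q⁻ᵏ` is an eigenvalue. -/
theorem hasEigenvalue_psymOp (hq : 1 < q) {z₀ : ℂ} (hz₀ : z₀ ≠ 0)
    (h : 1 - (q : ℂ)⁻¹ - z₀⁻¹ + (q : ℂ)⁻¹ * z₀ = 0) (k : ℕ) :
    Module.End.HasEigenvalue (psymOp q : ℓ₂ →ₗ[ℂ] ℓ₂) (z₀⁻¹ * (q : ℂ)⁻¹ ^ k) := by
  have hq0 : q ≠ 0 := by linarith
  have hqC : (q : ℂ) ≠ 0 := by exact_mod_cast hq0
  have hinjR : Function.Injective fun m : ℕ => q ^ m := pow_right_injective₀ (by linarith) hq.ne'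
  have hinj : Function.Injective fun m : ℕ => (q : ℂ) ^ m := fun m n hmn =>
    hinjR (by simp only at hmn ⊢; exact_mod_cast hmn)
  have hz : ∀ m, z₀ * (q : ℂ) ^ m ≠ 0 := fun m => mul_ne_zero hz₀ (pow_ne_zero _ hqC)
  obtain ⟨c, hck, hc⟩ := exists_eigenvector_of_triangular (psymOp q : ℓ₂ →ₗ[ℂ] ℓ₂)
    (fun m => psymGeom hq (hz m)) (fun m => z₀⁻¹ * (q : ℂ)⁻¹ ^ m)
    (fun m => 1 - (q : ℂ)⁻¹ - (z₀ * q ^ (m + 1))⁻¹ + (q : ℂ)⁻¹ * (z₀ * q ^ (m + 1)))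
    (fun m n hmn => hinj (by
      have := mul_left_cancel₀ (inv_ne_zero hz₀) hmn
      simpa using this))
    (by
      ext i
      simp only [ContinuousLinearMap.coe_coe, psymOp_psymGeom_apply]
      simp [h])
    (fun m => by
      ext i
      simp only [ContinuousLinearMap.coe_coe, psymOp_psymGeom_apply, lp.coeFn_add, lp.coeFn_smul,
        Pi.add_apply, Pi.smul_apply, smul_eq_mul, psymGeom_apply]
      have h1 : (q : ℂ)⁻¹ * (z₀ * q ^ (m + 1)) = z₀ * q ^ m := by
        field_simp
        ring
      rw [h1, mul_inv, inv_pow])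
    k
  refine Module.End.hasEigenvalue_of_hasEigenvector
    ⟨Module.End.mem_eigenspace_iff.2 hc, fun h0 => ?_⟩
  let P : Polynomial ℂ := ∑ m ∈ Finset.range (k + 1), Polynomial.C (c m) * Polynomial.X ^ m
  have hroot : ∀ i : ℕ, P.IsRoot ((q : ℂ) ^ i) := fun i => by
    have h1 := congrArg (fun f : ℓ₂ => f i) h0
    simp only [lp.coeFn_sum, Finset.sum_apply, lp.coeFn_smul, Pi.smul_apply, psymGeom_apply,
      lp.coeFn_zero, Pi.zero_apply, smul_eq_mul] at h1
    have hw : z₀ ^ i * (psymWeight q i : ℂ) ≠ 0 :=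
      mul_ne_zero (pow_ne_zero _ hz₀) (by exact_mod_cast psymWeight_ne_zero hq i)
    refine (mul_eq_zero.1 ?_).resolve_left hw
    rw [← h1, Polynomial.eval_finsetSum, Finset.mul_sum]
    refine Finset.sum_congr rfl fun m _ => ?_
    simp only [Polynomial.eval_mul, Polynomial.eval_C, Polynomial.eval_pow, Polynomial.eval_X]
    ring
  have hP : P = 0 := Polynomial.eq_zero_of_infinite_isRoot P
    ((Set.infinite_range_of_injective hinj).mono (Set.range_subset_iff.2 hroot))
  have hk : P.coeff k = 1 := by
    simp [P, Polynomial.coeff_X_pow, hck]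
  simp [hP] at hk

/-- The eigenvalues `q⁻ᵏ` (`k ≥ 0`) and `-q⁻ᵏ` (`k ≥ 1`). -/
def psymEigenvalue (q : ℝ) : ℕ ⊕ ℕ → ℂ :=
  Sum.elim (fun k => (q : ℂ)⁻¹ ^ k) fun k => -(q : ℂ)⁻¹ ^ (k + 1)

theorem hasEigenvalue_psymEigenvalue (hq : 1 < q) (i : ℕ ⊕ ℕ) :
    Module.End.HasEigenvalue (psymOp q : ℓ₂ →ₗ[ℂ] ℓ₂) (psymEigenvalue q i) := by
  have hqC : (q : ℂ) ≠ 0 := by exact_mod_cast (by linarith : q ≠ 0)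
  rcases i with k | k
  · simpa [psymEigenvalue] using hasEigenvalue_psymOp hq one_ne_zero (by simp) k
  · have h := hasEigenvalue_psymOp hq (neg_ne_zero.2 hqC) (by field_simp; ring) k
    convert! h using 1
    simp only [psymEigenvalue, Sum.elim_inr, pow_succ, inv_neg]
    ring

theorem psymEigenvalue_injective (hq : 1 < q) : Function.Injective (psymEigenvalue q) := by
  have hq0 : 0 < q⁻¹ := inv_pos.2 (by linarith)
  have hinj := pow_right_injective₀ hq0 (inv_lt_one_of_one_lt₀ hq).ne
  have key : ∀ k l : ℕ, q⁻¹ ^ k ≠ -q⁻¹ ^ l := fun k l =>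
    ((neg_lt_zero.2 (pow_pos hq0 l)).trans (pow_pos hq0 k)).ne'
  rintro (k | k) (l | l) h <;> simp only [psymEigenvalue, Sum.elim_inl, Sum.elim_inr] at h
  · exact congrArg _ (hinj (by simp only; exact_mod_cast h))
  · exact absurd (by exact_mod_cast h) (key k (l + 1))
  · exact absurd (by exact_mod_cast h.symm) (key l (k + 1))
  · have := hinj (a₁ := k + 1) (a₂ := l + 1) (by simp only; exact_mod_cast neg_injective h)
    rw [Nat.succ_injective this]

theorem hasSum_norm_sq_psymEigenvalue (hq : 1 < q) :
    HasSum (fun i => ‖psymEigenvalue q i‖ ^ 2) ((1 + q⁻¹ ^ 2) / (1 - q⁻¹ ^ 2)) := by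
  have ht0 : 0 < q⁻¹ := inv_pos.2 (by linarith)
  have ht1 : q⁻¹ < 1 := inv_lt_one_of_one_lt₀ hq
  have h2 := hasSum_geometric_of_lt_one (r := q⁻¹ ^ 2) (by positivity) (by nlinarith)
  have hn : |q| = q := abs_of_pos (by linarith)
  rw [add_div, one_div, div_eq_mul_inv]
  refine HasSum.sum ?_ ?_
  · refine h2.congr_fun fun k => ?_
    simp [psymEigenvalue, hn, ← pow_mul, mul_comm]
  · refine (h2.mul_left _).congr_fun fun k => ?_
    simp [psymEigenvalue, hn]
    ring

theorem hasEigenvalue_psymOp_iff (hq : 1 < q) (μ : ℂ) :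
    Module.End.HasEigenvalue (psymOp q : ℓ₂ →ₗ[ℂ] ℓ₂) μ ↔ μ ∈ Set.range (psymEigenvalue q) := by
  refine ⟨fun hμ => ?_, ?_⟩
  · by_contra hne
    have hle : ∀ s : Finset (ℕ ⊕ ℕ), ∑ i ∈ s, ‖psymEigenvalue q i‖ ^ 2
        ≤ (1 + q⁻¹ ^ 2) / (1 - q⁻¹ ^ 2) - ‖μ‖ ^ 2 := fun s => by
      have h := sum_sq_eigenvalues_le
        (isSymmetric_jacobi psymOff_zero (summable_psymDiag hq) (summable_psymOff hq))
        (hasSum_norm_sq_psymOp_single hq)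
        (Finset.cons μ (s.map ⟨_, psymEigenvalue_injective hq⟩) (by
          simp only [Finset.mem_map, Function.Embedding.coeFn_mk, not_exists, not_and]
          exact fun i _ hi => hne ⟨i, hi⟩))
        (by
          simp only [Finset.mem_cons, Finset.mem_map, Function.Embedding.coeFn_mk]
          rintro ν (rfl | ⟨i, _, rfl⟩)
          · exact hμ
          · exact hasEigenvalue_psymEigenvalue hq i)
      rw [Finset.sum_cons, Finset.sum_map] at h
      simp only [Function.Embedding.coeFn_mk] at h
      linarith
    have h := hasSum_le_of_sum_le (hasSum_norm_sq_psymEigenvalue hq) hle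
    have hμ0 : μ = 0 := by
      rw [← norm_eq_zero]
      nlinarith [norm_nonneg μ]
    obtain ⟨v, hv⟩ := hμ.exists_hasEigenvector
    refine hv.2 (psymOp_injective hq ?_)
    simpa [hμ0] using hv.apply_eq_smul
  · rintro ⟨i, rfl⟩
    exact hasEigenvalue_psymEigenvalue hq i

theorem alphaQ_ne_zero (hq : 1 < q) : alphaQ q ≠ 0 := by
  have ht0 : 0 < q⁻¹ := inv_pos.2 (by linarith)
  have ht1 : q⁻¹ < 1 := inv_lt_one_of_one_lt₀ hq
  have h := tprod_one_add_ne_zero_of_summable (f := fun i : ℕ => -q⁻¹ ^ (2 * i + 1)) ?_ ?_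
  · simpa [alphaQ, sub_eq_add_neg] using h
  · intro i
    have := pow_lt_one₀ ht0.le ht1 (n := 2 * i + 1) (by omega)
    linarith
  · have := (summable_geometric_of_lt_one ht0.le ht1).comp_injective
      (i := fun i : ℕ => 2 * i + 1) (fun a b h => by simpa using h)
    simpa using this.norm

theorem piSym_ne_zero (hq : 1 < q) (k : ℕ) : piSym q k ≠ 0 :=
  div_ne_zero (alphaQ_ne_zero hq)
    (Finset.prod_ne_zero_iff.2 fun i _ => (pow_succ_sub_one_pos hq i).ne')

theorem piSym_div_piSym_succ (hq : 1 < q) (k : ℕ) :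
    piSym q k / piSym q (k + 1) = q ^ (k + 1) - 1 := by
  have h0 := alphaQ_ne_zero hq
  have h1 : ∏ i ∈ Finset.range k, (q ^ (i + 1) - 1) ≠ 0 :=
    Finset.prod_ne_zero_iff.2 fun i _ => (pow_succ_sub_one_pos hq i).ne'
  have h2 := (pow_succ_sub_one_pos hq k).ne'
  rw [piSym, piSym, Finset.prod_range_succ]
  field_simp

theorem psym_mul_sqrt (hq : 1 < q) (k j : ℕ) :
    ((Psym q k j * √(piSym q k / piSym q j) : ℝ) : ℂ)
      = jacobiCol (psymDiag q) (psymOff q) k j := by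
  have hq0 : q ≠ 0 := by linarith
  simp only [jacobiCol, lp.coeFn_add, Pi.add_apply, lp.single_apply, Pi.single_apply]
  by_cases h1 : j = k + 1
  · subst h1
    simp [Psym, psymOff, piSym_div_piSym_succ hq, show k + 1 ≠ k - 1 by omega]
  by_cases h2 : j = k
  · subst h2
    have h3 : (if j = j - 1 then (psymOff q j : ℂ) else 0) = 0 := by
      rcases j with _ | j <;> simp
    rw [h3]
    simp [Psym, psymDiag, div_self (piSym_ne_zero hq j), pow_succ]
    ring
  by_cases h3 : k = j + 1
  · subst h3
    have h4 : Psym q (j + 1) j * √(piSym q (j + 1) / piSym q j) = psymOff q (j + 1) := by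
      have hs := Real.sqrt_pos.2 (pow_succ_sub_one_pos hq j)
      have h5 := sq_sqrt_pow_sub_one hq (j + 1)
      rw [← inv_div, piSym_div_piSym_succ hq, Real.sqrt_inv, psymOff]
      simp only [Psym, show j ≠ j + 1 + 1 by omega, show j ≠ j + 1 by omega, if_false, if_true]
      rw [← div_eq_mul_inv, div_eq_iff hs.ne', mul_assoc, ← sq, h5, mul_sub, ← mul_pow,
        inv_mul_cancel₀ hq0, one_pow, mul_one]
    rw [h4]
    simp [show j ≠ j + 1 + 1 by omega]
  · have h4 : (if j = k - 1 then (psymOff q k : ℂ) else 0) = 0 := by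
      rcases k with _ | k
      · simp
      · rw [if_neg (by omega)]
    simp [Psym, h1, h2, h3, h4]

end Psym

/-- For a prime power `q`, the operator `μ ↦ μP_sym` on `ℓ²(π_sym)`
(realized on standard `ℓ²(ℕ,ℂ)` via `μ ↦ (μ(i)/√π_sym(i))`) is Hilbert–Schmidt (in particular
compact) and self-adjoint, with eigenvalue set exactly `{±q^{-k} : k ≥ 0} \ {−1}`. -/
theorem stmt12 (q : ℕ) (hq : IsPrimePow q) :
    ∃ T : lp (fun _ : ℕ => ℂ) 2 →L[ℂ] lp (fun _ : ℕ => ℂ) 2,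
      (∀ (f : lp (fun _ : ℕ => ℂ) 2) (j : ℕ),
        T f j = ∑' i : ℕ,
          f i * ((Psym q i j * Real.sqrt (piSym q i / piSym q j) : ℝ) : ℂ)) ∧
      Summable (fun k : ℕ => ‖T (lp.single 2 k 1)‖ ^ 2) ∧
      IsCompactOperator T ∧
      IsSelfAdjoint T ∧
      (∀ μ : ℂ,
        Module.End.HasEigenvalue
            (T : lp (fun _ : ℕ => ℂ) 2 →ₗ[ℂ] lp (fun _ : ℕ => ℂ) 2) μ
          ↔ (∃ k : ℕ, μ = ((q : ℂ))⁻¹ ^ k) ∨ (∃ k : ℕ, 1 ≤ k ∧ μ = -((q : ℂ))⁻¹ ^ k)) := by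
  have hq1 : (1 : ℝ) < q := by exact_mod_cast hq.one_lt
  have ha := summable_psymDiag hq1
  have hβ := summable_psymOff hq1
  refine ⟨psymOp q, fun f j => ?_, (hasSum_norm_sq_psymOp_single hq1).summable,
    isCompactOperator_jacobi ha hβ,
    (ContinuousLinearMap.isSelfAdjoint_iff_isSymmetric).2 (isSymmetric_jacobi psymOff_zero ha hβ),
    fun μ => ?_⟩
  · simp only [psym_mul_sqrt hq1]
    exact (hasSum_jacobi_apply_coord ha hβ f j).tsum_eq.symm
  · rw [hasEigenvalue_psymOp_iff hq1]
    simp only [Set.mem_range, Sum.exists, psymEigenvalue, Sum.elim_inl, Sum.elim_inr,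
      Complex.ofReal_natCast]
    refine or_congr (exists_congr fun k => eq_comm) ⟨?_, ?_⟩
    · rintro ⟨k, rfl⟩
      exact ⟨k + 1, by omega, rfl⟩
    · rintro ⟨k, hk, rfl⟩
      exact ⟨k - 1, by rw [Nat.sub_add_cancel hk]⟩
end
end

section
/- For every prime power q, the operators μ ↦ μP_alt on ℓ²(π_alt) and μ ↦ μQ_alt on ℓ²(π'_alt) are Hilbert–Schmidt (in particular compact) and self-adjoint, and in both cases the set of eigenvalues is exactly {q^{−2k} : k ≥ 0}. -/
noncomputable section

open scoped ENNReal

/-- `η_k(q) = ∏_{i=1}^{k} (1 - q^{-i})`. -/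
def etaF (q : ℝ) (k : ℕ) : ℝ := ∏ i ∈ Finset.range k, (1 - q⁻¹ ^ (i + 1))

/-- The transition matrix `P_alt` (odd-size alternating matrices). -/
def Palt (q : ℝ) (i j : ℕ) : ℝ :=
  if j = i + 1 then q⁻¹ ^ (4 * i + 3)
  else if j = i then 1 - q⁻¹ ^ (4 * i + 3) - (1 - q⁻¹ ^ (2 * i)) * (1 - q⁻¹ ^ (2 * i + 1))
  else if i = j + 1 then (1 - q⁻¹ ^ (2 * i)) * (1 - q⁻¹ ^ (2 * i + 1))
  else 0

/-- The transition matrix `Q_alt` (even-size alternating matrices). -/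
def Qalt (q : ℝ) (i j : ℕ) : ℝ :=
  if j = i + 1 then q⁻¹ ^ (4 * i + 1)
  else if j = i then 1 - q⁻¹ ^ (4 * i + 1) - (1 - q⁻¹ ^ (2 * i)) * (1 - q⁻¹ ^ (2 * i - 1))
  else if i = j + 1 then (1 - q⁻¹ ^ (2 * i)) * (1 - q⁻¹ ^ (2 * i - 1))
  else 0

/-- `π_alt(j) = α(q)/(q^{2j²+j}·η_{2j+1}(q))`. -/
def piAlt (q : ℝ) (j : ℕ) : ℝ := alphaQ q / (q ^ (2 * j ^ 2 + j) * etaF q (2 * j + 1))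

/-- `π'_alt(j) = α(q)/(q^{2j²−j}·η_{2j}(q))`. -/
def piAlt' (q : ℝ) (j : ℕ) : ℝ := alphaQ q / (q ^ (2 * j ^ 2 - j) * etaF q (2 * j))

open Filter Topology Finset InnerProductSpace

/-- The Hilbert space `ℓ²(ℕ, ℂ)`. -/
abbrev SqSum : Type := lp (fun _ : ℕ => ℂ) 2

/-- The standard basis vector of `ℓ²(ℕ, ℂ)` at `n`. -/
abbrev basisVec (n : ℕ) : SqSum := lp.single 2 n 1

/-- The contribution of `b n` and `a n` to the Jacobi operator with diagonal `b` and
off-diagonal `a`. -/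
def jacobiTerm (a b : ℕ → ℝ) (n : ℕ) : SqSum →L[ℂ] SqSum :=
  (b n : ℂ) • rankOne ℂ (basisVec n) (basisVec n) +
    (a n : ℂ) • (rankOne ℂ (basisVec n) (basisVec (n + 1)) +
      rankOne ℂ (basisVec (n + 1)) (basisVec n))

/-- The Jacobi operator with diagonal `b` and off-diagonal `a`. -/
def jacobiOp (a b : ℕ → ℝ) : SqSum →L[ℂ] SqSum := ∑' n, jacobiTerm a b n

theorem norm_basisVec (n : ℕ) : ‖basisVec n‖ = 1 := by
  rw [lp.norm_single (by norm_num)]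
  simp

theorem norm_jacobiTerm_le (a b : ℕ → ℝ) (n : ℕ) :
    ‖jacobiTerm a b n‖ ≤ |b n| + |a n| * 2 := by
  unfold jacobiTerm
  refine (norm_add_le _ _).trans (add_le_add ?_ ?_)
  · rw [norm_smul, norm_rankOne, norm_basisVec]
    simp
  · rw [norm_smul]
    refine mul_le_mul (by simp) ((norm_add_le _ _).trans ?_) (norm_nonneg _) (abs_nonneg _)
    rw [norm_rankOne, norm_rankOne, norm_basisVec, norm_basisVec]
    norm_num

theorem isSelfAdjoint_jacobiTerm (a b : ℕ → ℝ) (n : ℕ) : IsSelfAdjoint (jacobiTerm a b n) := by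
  rw [ContinuousLinearMap.isSelfAdjoint_iff']
  simp only [jacobiTerm, map_add, LinearIsometryEquiv.map_smulₛₗ, adjoint_rankOne,
    Complex.conj_ofReal]
  rw [add_comm (rankOne ℂ (basisVec (n + 1)) (basisVec n))]

theorem isCompactOperator_rankOne (x y : SqSum) : IsCompactOperator (rankOne ℂ x y) := by
  rw [rankOne_def']
  have h : IsCompactOperator (innerSL ℂ y) := by
    have := (isCompactOperator_id_iff_finiteDimensional (𝕜 := ℂ) (E := ℂ)).2 inferInstance
    exact this.comp_clm (innerSL ℂ y)
  exact h.clm_comp (ContinuousLinearMap.toSpanSingleton ℂ x)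

theorem isCompactOperator_jacobiTerm (a b : ℕ → ℝ) (n : ℕ) :
    IsCompactOperator (jacobiTerm a b n) :=
  ((isCompactOperator_rankOne _ _).smul _).add
    (((isCompactOperator_rankOne _ _).add (isCompactOperator_rankOne _ _)).smul _)

theorem jacobiTerm_apply (a b : ℕ → ℝ) (n : ℕ) (f : SqSum) (j : ℕ) :
    jacobiTerm a b n f j =
      (if j = n then b n * f n + a n * f (n + 1) else 0) +
        (if j = n + 1 then a n * f n else 0) := by
  have h (m : ℕ) : (basisVec m : ℕ → ℂ) j = if j = m then 1 else 0 := by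
    rw [lp.coeFn_single, Pi.single_apply]
  simp only [jacobiTerm, _root_.add_apply, _root_.smul_apply,
    rankOne_apply, lp.inner_single_left, lp.coeFn_add, lp.coeFn_smul, Pi.add_apply,
    Pi.smul_apply, h, smul_eq_mul]
  split_ifs <;> simp
  ring

section Summable

variable {a b : ℕ → ℝ}

theorem summable_jacobiTerm (ha : Summable a) (hb : Summable b) : Summable (jacobiTerm a b) :=
  .of_norm_bounded (hb.abs.add (ha.abs.mul_right 2)) (norm_jacobiTerm_le a b)

theorem isSelfAdjoint_jacobiOp (ha : Summable a) (hb : Summable b) :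
    IsSelfAdjoint (jacobiOp a b) := by
  have h := (summable_jacobiTerm ha hb).hasSum
  have h' := h.star
  simp only [(isSelfAdjoint_jacobiTerm a b _).star_eq] at h'
  exact h'.unique h

theorem isCompactOperator_jacobiOp (ha : Summable a) (hb : Summable b) :
    IsCompactOperator (jacobiOp a b) := by
  refine isClosed_setOfPred_isCompactOperator.mem_of_tendsto (summable_jacobiTerm ha hb).hasSum
    (Eventually.of_forall fun s => ?_)
  exact (compactOperator (RingHom.id ℂ) SqSum SqSum).sum_mem
    fun n _ => isCompactOperator_jacobiTerm a b n

theorem hasSum_jacobiTerm_apply (ha : Summable a) (hb : Summable b) (f : SqSum) (j : ℕ) :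
    HasSum (fun n => jacobiTerm a b n f j) (jacobiOp a b f j) := by
  have h := (summable_jacobiTerm ha hb).hasSum.mapL (ContinuousLinearMap.apply ℂ SqSum f)
  have h' := h.mapL (innerSL ℂ (basisVec j))
  simpa [lp.inner_single_left, jacobiOp] using h'

theorem jacobiOp_apply_zero (ha : Summable a) (hb : Summable b) (f : SqSum) :
    jacobiOp a b f 0 = b 0 * f 0 + a 0 * f 1 := by
  refine (hasSum_jacobiTerm_apply ha hb f 0).unique ?_
  convert hasSum_single (L := .unconditional ℕ) (f := fun n => jacobiTerm a b n f 0) 0 ?_ using 1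
  · simp [jacobiTerm_apply]
  · intro n hn
    simp [jacobiTerm_apply, hn.symm]

theorem jacobiOp_apply_succ (ha : Summable a) (hb : Summable b) (f : SqSum) (j : ℕ) :
    jacobiOp a b f (j + 1) = a j * f j + b (j + 1) * f (j + 1) + a (j + 1) * f (j + 2) := by
  refine (hasSum_jacobiTerm_apply ha hb f (j + 1)).unique ?_
  convert hasSum_sum_of_ne_finset_zero (L := .unconditional ℕ) (f := fun n => jacobiTerm a b n f (j + 1))
    (s := {j, j + 1}) ?_ using 1
  · rw [Finset.sum_pair (by omega)]
    simp [jacobiTerm_apply]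
    ring
  · intro n hn
    simp only [Finset.mem_insert, Finset.mem_singleton, not_or] at hn
    rw [jacobiTerm_apply, if_neg (by omega), if_neg (by omega), add_zero]

theorem norm_sq_jacobiOp_basisVec_zero (ha : Summable a) (hb : Summable b) :
    ‖jacobiOp a b (basisVec 0)‖ ^ 2 = b 0 ^ 2 + a 0 ^ 2 := by
  have h := lp.hasSum_norm (by norm_num) (jacobiOp a b (basisVec 0))
  simp only [ENNReal.toReal_ofNat, Real.rpow_ofNat] at h
  refine h.unique ?_
  convert hasSum_sum_of_ne_finset_zero (L := .unconditional ℕ) (s := Finset.range 2) ?_ using 1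
  · simp [Finset.sum_range_succ, jacobiOp_apply_zero ha hb, jacobiOp_apply_succ ha hb]
  · rintro (_ | n) hn
    · simp at hn
    · simp only [Finset.mem_range] at hn
      simp [jacobiOp_apply_succ ha hb, show n ≠ 0 by omega]

theorem norm_sq_jacobiOp_basisVec_succ (ha : Summable a) (hb : Summable b) (k : ℕ) :
    ‖jacobiOp a b (basisVec (k + 1))‖ ^ 2 = a k ^ 2 + b (k + 1) ^ 2 + a (k + 1) ^ 2 := by
  have h := lp.hasSum_norm (by norm_num) (jacobiOp a b (basisVec (k + 1)))
  simp only [ENNReal.toReal_ofNat, Real.rpow_ofNat] at h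
  refine h.unique ?_
  convert hasSum_sum_of_ne_finset_zero (L := .unconditional ℕ) (s := {k, k + 1, k + 2}) ?_ using 1
  · rw [Finset.sum_insert (by simp), Finset.sum_pair (by omega)]
    rcases k with _ | k <;>
    simp [jacobiOp_apply_zero ha hb, jacobiOp_apply_succ ha hb, add_assoc]
  · rintro (_ | n) hn <;>
    simp only [Finset.mem_insert, Finset.mem_singleton, not_or] at hn
    · simp [jacobiOp_apply_zero ha hb, show k ≠ 0 by omega]
    · rw [jacobiOp_apply_succ ha hb]
      simp [show n ≠ k + 1 by omega, show n ≠ k by omega,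
        show n + 1 ≠ k by omega]

theorem hasSum_norm_sq_jacobiOp_basisVec (ha : Summable a) (hb : Summable b) {A B : ℝ}
    (hA : HasSum (fun n => a n ^ 2) A) (hB : HasSum (fun n => b n ^ 2) B) :
    HasSum (fun k => ‖jacobiOp a b (basisVec k)‖ ^ 2) (B + 2 * A) := by
  rw [← hasSum_nat_add_iff' 1, Finset.sum_range_one, norm_sq_jacobiOp_basisVec_zero ha hb,
    funext (norm_sq_jacobiOp_basisVec_succ ha hb)]
  have hA' := (hasSum_nat_add_iff' 1).2 hA
  have hB' := (hasSum_nat_add_iff' 1).2 hB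
  rw [Finset.sum_range_one] at hA' hB'
  have e : B + 2 * A - (b 0 ^ 2 + a 0 ^ 2) = A + (B - b 0 ^ 2) + (A - a 0 ^ 2) := by ring
  rw [e]
  exact (hA.add hB').add hA'

end Summable

/-- If finitely many eigenvalues of a self-adjoint operator are given, the sum of their squares
is at most the square of the Hilbert-Schmidt norm. -/
theorem sum_norm_sq_eigenvalues_le {T : SqSum →L[ℂ] SqSum} (hT : IsSelfAdjoint T) {S : ℝ}
    (hS : HasSum (fun k => ‖T (basisVec k)‖ ^ 2) S) (s : Finset ℂ)
    (hs : ∀ μ ∈ s, Module.End.HasEigenvalue (T : SqSum →ₗ[ℂ] SqSum) μ) :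
    ∑ μ ∈ s, ‖μ‖ ^ 2 ≤ S := by
  have hsymm : (T : SqSum →ₗ[ℂ] SqSum).IsSymmetric := hT.isSymmetric
  have hex (μ : s) : ∃ v : SqSum, T v = (μ : ℂ) • v ∧ ‖v‖ = 1 := by
    obtain ⟨v, hv⟩ := (hs μ μ.2).exists_hasEigenvector
    have hv0 : ‖v‖ ≠ 0 := norm_ne_zero_iff.2 hv.2
    refine ⟨((‖v‖⁻¹ : ℝ) : ℂ) • v, ?_, ?_⟩
    · have : T v = (μ : ℂ) • v := hv.apply_eq_smul
      rw [map_smul, this, smul_comm]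
    · rw [norm_smul]
      simp [hv0]
  choose v hv hv1 using hex
  have hortho : Orthonormal ℂ v := by
    refine ⟨hv1, fun μ ν hμν => ?_⟩
    exact hsymm.orthogonalFamily_eigenspaces (fun h => hμν (Subtype.ext h))
      ⟨v μ, Module.End.mem_eigenspace_iff.2 (hv μ)⟩ ⟨v ν, Module.End.mem_eigenspace_iff.2 (hv ν)⟩
  have hnorm (μ : s) : HasSum (fun k => ‖inner ℂ (v μ) (T (basisVec k))‖ ^ 2) (‖(μ : ℂ)‖ ^ 2) := by
    have h := lp.hasSum_norm (by norm_num) (T (v μ))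
    simp only [ENNReal.toReal_ofNat, Real.rpow_ofNat] at h
    have h1 : ‖T (v μ)‖ = ‖(μ : ℂ)‖ := by rw [hv, norm_smul, hv1, mul_one]
    rw [h1] at h
    convert h using 3 with k
    have h2 : inner ℂ (v μ) (T (basisVec k)) = inner ℂ (T (v μ)) (basisVec k) :=
      (hsymm (v μ) (basisVec k)).symm
    rw [h2, lp.inner_single_right]
    simp
  rw [← Finset.sum_coe_sort]
  exact hasSum_le (fun k => hortho.sum_inner_products_le (T (basisVec k)))
    (hasSum_sum fun μ _ => hnorm μ) hS

/-- The off-diagonal entries of the symmetrized birth-death chain with birth probabilities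
`r * t ^ (2 * i + 1)` and death probabilities `(1 - t ^ i) * (1 - r * t ^ i)`. -/
def offDiagEntry (t r : ℝ) (i : ℕ) : ℝ :=
  √(r * t ^ (2 * i + 1) * ((1 - t ^ (i + 1)) * (1 - r * t ^ (i + 1))))

/-- The diagonal entries of the birth-death chain with birth probabilities
`r * t ^ (2 * i + 1)` and death probabilities `(1 - t ^ i) * (1 - r * t ^ i)`. -/
def diagEntry (t r : ℝ) (i : ℕ) : ℝ :=
  1 - r * t ^ (2 * i + 1) - (1 - t ^ i) * (1 - r * t ^ i)

/-- Square roots of the stationary weights, normalized by `1` at `0`. -/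
def sqrtWeight (t r : ℝ) (n : ℕ) : ℝ :=
  ∏ i ∈ range n, offDiagEntry t r i / ((1 - t ^ (i + 1)) * (1 - r * t ^ (i + 1)))

/-- The finite `q`-Pochhammer product `∏_{j < m} (1 - z t ^ j)`. -/
def pochProd (t : ℝ) (m : ℕ) (z : ℝ) : ℝ := ∏ j ∈ range m, (1 - z * t ^ j)

/-- Coefficients, in the basis `pochProd t m`, of the eigenfunction with eigenvalue `t ^ k`. -/
def eigenCoeff (t r : ℝ) (k m : ℕ) : ℝ :=
  ∏ l ∈ range m, (t ^ l - t ^ k) / ((1 - t ^ (l + 1)) * (r * t ^ l))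

/-- The eigenfunction with eigenvalue `t ^ k`, as a polynomial in `z = t ^ (-i)`. -/
def eigenPoly (t r : ℝ) (k : ℕ) (z : ℝ) : ℝ :=
  ∑ m ∈ range (k + 1), eigenCoeff t r k m * pochProd t m z

theorem pochProd_birthDeath {t r z : ℝ} (ht : t ≠ 0) (hz : z ≠ 0) (n : ℕ) :
    r * t / z ^ 2 * (pochProd t (n + 1) (z / t) - pochProd t (n + 1) z) +
      (1 - 1 / z) * (1 - r / z) * (pochProd t (n + 1) (z * t) - pochProd t (n + 1) z) +
        pochProd t (n + 1) z =
      t ^ (n + 1) * pochProd t (n + 1) z - (1 - t ^ (n + 1)) * (r * t ^ n) * pochProd t n z := by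
  have h1 : pochProd t (n + 1) (z / t) = (1 - z / t) * pochProd t n z := by
    rw [pochProd, prod_range_succ', mul_comm, pochProd]
    congr 1
    · simp
    · refine prod_congr rfl fun j _ => ?_
      field_simp
      ring
  have h2 : pochProd t (n + 1) z = (1 - z * t ^ n) * pochProd t n z := by
    rw [pochProd, prod_range_succ, mul_comm, pochProd]
  have h3 : (1 - z) * pochProd t (n + 1) (z * t) =
      (1 - z * t ^ (n + 1)) * ((1 - z * t ^ n) * pochProd t n z) := by
    have e : (1 - z) * pochProd t (n + 1) (z * t) = pochProd t (n + 2) z := by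
      rw [pochProd, pochProd, prod_range_succ' _ (n + 1), mul_comm]
      congr 1
      · refine prod_congr rfl fun j _ => ?_
        ring
      · simp
    rw [e, pochProd, prod_range_succ, prod_range_succ, pochProd]
    ring
  have h4 : (1 - 1 / z) * (1 - r / z) * pochProd t (n + 1) (z * t) =
      -(1 / z) * (1 - r / z) * ((1 - z * t ^ (n + 1)) * ((1 - z * t ^ n) * pochProd t n z)) := by
    rw [← h3]
    field_simp
    ring
  rw [mul_sub ((1 - 1 / z) * (1 - r / z)), h4, h1, h2]
  field_simp
  ring

theorem abs_pochProd_le {t z : ℝ} (ht0 : 0 < t) (ht1 : t < 1) (hz : 1 ≤ z) (m : ℕ) :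
    |pochProd t m z| ≤ (2 * z) ^ m := by
  rw [pochProd, abs_prod]
  calc ∏ j ∈ range m, |1 - z * t ^ j| ≤ ∏ _j ∈ range m, 2 * z := by
        refine prod_le_prod (fun _ _ => abs_nonneg _) fun j _ => ?_
        have h0 : 0 ≤ t ^ j := by positivity
        have h1 : t ^ j ≤ 1 := pow_le_one₀ ht0.le ht1.le
        rw [abs_le]
        constructor <;> nlinarith
    _ = (2 * z) ^ m := by simp

theorem eigenPoly_one {t r : ℝ} (k : ℕ) : eigenPoly t r k 1 = 1 := by
  rw [eigenPoly, sum_range_succ', sum_eq_zero]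
  · simp [eigenCoeff, pochProd]
  · intro m _
    rw [pochProd, prod_range_succ']
    simp

section Parameters

variable {t r : ℝ}

theorem eigenPoly_birthDeath (ht0 : 0 < t) (ht1 : t < 1) (hr : 0 < r) {z : ℝ} (hz : z ≠ 0)
    (k : ℕ) :
    r * t / z ^ 2 * (eigenPoly t r k (z / t) - eigenPoly t r k z) +
      (1 - 1 / z) * (1 - r / z) * (eigenPoly t r k (z * t) - eigenPoly t r k z) +
        eigenPoly t r k z = t ^ k * eigenPoly t r k z := by
  have key (m : ℕ) : r * t / z ^ 2 * (pochProd t m (z / t) - pochProd t m z) +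
      (1 - 1 / z) * (1 - r / z) * (pochProd t m (z * t) - pochProd t m z) + pochProd t m z =
      t ^ m * pochProd t m z - (1 - t ^ m) * (r * t ^ (m - 1)) * pochProd t (m - 1) z := by
    rcases m with _ | m
    · simp [pochProd]
    · exact pochProd_birthDeath ht0.ne' hz m
  have hc (m : ℕ) : eigenCoeff t r k (m + 1) * ((1 - t ^ (m + 1)) * (r * t ^ m)) =
      eigenCoeff t r k m * (t ^ m - t ^ k) := by
    have h1 : 1 - t ^ (m + 1) ≠ 0 := (sub_pos.2 (pow_lt_one₀ ht0.le ht1 (by omega))).ne'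
    rw [eigenCoeff, prod_range_succ, ← eigenCoeff]
    field_simp
  have hL : r * t / z ^ 2 * (eigenPoly t r k (z / t) - eigenPoly t r k z) +
      (1 - 1 / z) * (1 - r / z) * (eigenPoly t r k (z * t) - eigenPoly t r k z) +
        eigenPoly t r k z = ∑ m ∈ range (k + 1), eigenCoeff t r k m *
          (t ^ m * pochProd t m z - (1 - t ^ m) * (r * t ^ (m - 1)) * pochProd t (m - 1) z) := by
    simp only [← key, eigenPoly, ← sum_sub_distrib, mul_sum, ← sum_add_distrib]
    refine sum_congr rfl fun m _ => ?_
    ring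
  have hsum : ∑ m ∈ range (k + 1),
      eigenCoeff t r k m * ((1 - t ^ m) * (r * t ^ (m - 1)) * pochProd t (m - 1) z) =
      ∑ m ∈ range (k + 1), eigenCoeff t r k m * (t ^ m - t ^ k) * pochProd t m z := by
    rw [sum_range_succ', sum_range_succ]
    simp only [← hc, Nat.add_sub_cancel, pow_zero, sub_self, zero_mul, mul_zero, add_zero,
      mul_assoc]
  rw [hL]
  simp only [mul_sub, sum_sub_distrib]
  rw [hsum, eigenPoly, mul_sum, ← sum_sub_distrib]
  refine sum_congr rfl fun m _ => ?_
  ring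

theorem diagEntry_eq (i : ℕ) :
    diagEntry t r i = (1 + r) * t ^ i - r * (1 + t) * t ^ (2 * i) := by
  rw [diagEntry]
  ring

theorem one_sub_pow_pos (ht0 : 0 < t) (ht1 : t < 1) (i : ℕ) : 0 < 1 - t ^ (i + 1) :=
  sub_pos.2 (pow_lt_one₀ ht0.le ht1 (by omega))

theorem mul_pow_succ_le (ht0 : 0 < t) (ht1 : t < 1) (hr : 0 < r) (hrt : r * t ≤ 1 / 2) (i : ℕ) :
    r * t ^ (i + 1) ≤ 1 / 2 := by
  have h : t ^ i ≤ 1 := pow_le_one₀ ht0.le ht1.le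
  calc r * t ^ (i + 1) = r * t * t ^ i := by ring
    _ ≤ r * t * 1 := by gcongr
    _ ≤ 1 / 2 := by rwa [mul_one]

theorem offDiagEntry_sq (ht0 : 0 < t) (ht1 : t < 1) (hr : 0 < r) (hrt : r * t ≤ 1 / 2) (i : ℕ) :
    offDiagEntry t r i ^ 2 =
      r * t ^ (2 * i + 1) * ((1 - t ^ (i + 1)) * (1 - r * t ^ (i + 1))) := by
  have h1 := one_sub_pow_pos ht0 ht1 i
  have h2 := mul_pow_succ_le ht0 ht1 hr hrt i
  have h3 : 0 < 1 - r * t ^ (i + 1) := by linarith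
  exact Real.sq_sqrt (by positivity)

theorem offDiagEntry_pos (ht0 : 0 < t) (ht1 : t < 1) (hr : 0 < r) (hrt : r * t ≤ 1 / 2) (i : ℕ) :
    0 < offDiagEntry t r i := by
  have h1 := one_sub_pow_pos ht0 ht1 i
  have h2 := mul_pow_succ_le ht0 ht1 hr hrt i
  have h3 : 0 < 1 - r * t ^ (i + 1) := by linarith
  exact Real.sqrt_pos.2 (by positivity)

theorem summable_diagEntry (ht0 : 0 < t) (ht1 : t < 1) : Summable (diagEntry t r) := by
  have h1 := (summable_geometric_of_lt_one ht0.le ht1).mul_left (1 + r)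
  have h2 := (summable_geometric_of_lt_one (sq_nonneg t)
    (pow_lt_one₀ ht0.le ht1 two_ne_zero)).mul_left (r * (1 + t))
  refine (h1.sub h2).congr fun i => ?_
  rw [diagEntry_eq, pow_mul]

theorem summable_offDiagEntry (ht0 : 0 < t) (ht1 : t < 1) (hr : 0 < r) (hrt : r * t ≤ 1 / 2) :
    Summable (offDiagEntry t r) := by
  refine .of_nonneg_of_le (fun i => Real.sqrt_nonneg _) (fun i => ?_)
    (summable_geometric_of_lt_one ht0.le ht1)
  have h0 : 0 < t ^ (i + 1) := by positivity
  have h1 := one_sub_pow_pos ht0 ht1 i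
  have h2 := mul_pow_succ_le ht0 ht1 hr hrt i
  have h3 : (1 - t ^ (i + 1)) * (1 - r * t ^ (i + 1)) ≤ 1 :=
    mul_le_one₀ (by linarith) (by linarith) (by nlinarith)
  refine Real.sqrt_le_iff.2 ⟨by positivity, ?_⟩
  calc r * t ^ (2 * i + 1) * ((1 - t ^ (i + 1)) * (1 - r * t ^ (i + 1)))
      ≤ r * t ^ (2 * i + 1) * 1 := by gcongr
    _ = r * t * (t ^ i) ^ 2 := by ring
    _ ≤ 1 * (t ^ i) ^ 2 := by gcongr; linarith
    _ = (t ^ i) ^ 2 := one_mul _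

theorem hasSum_norm_sq_birthDeath (ht0 : 0 < t) (ht1 : t < 1) (hr : 0 < r)
    (hrt : r * t ≤ 1 / 2) :
    HasSum (fun k => ‖jacobiOp (offDiagEntry t r) (diagEntry t r) (basisVec k)‖ ^ 2)
      (1 - t ^ 2)⁻¹ := by
  have hg (n : ℕ) : HasSum (fun i => (t ^ (n + 1)) ^ i) (1 - t ^ (n + 1))⁻¹ :=
    hasSum_geometric_of_lt_one (by positivity) (pow_lt_one₀ ht0.le ht1 (by omega))
  have hB : HasSum (fun i => diagEntry t r i ^ 2)
      ((1 + r) ^ 2 * (1 - t ^ 2)⁻¹ - 2 * r * (1 + r) * (1 + t) * (1 - t ^ 3)⁻¹ +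
        r ^ 2 * (1 + t) ^ 2 * (1 - t ^ 4)⁻¹) := by
    refine ((((hg 1).mul_left _).sub ((hg 2).mul_left _)).add ((hg 3).mul_left _)).congr_fun ?_
    intro i
    rw [diagEntry_eq]
    ring
  have hA : HasSum (fun i => offDiagEntry t r i ^ 2)
      (r * t * (1 - t ^ 2)⁻¹ - r * (1 + r) * t ^ 2 * (1 - t ^ 3)⁻¹ +
        r ^ 2 * t ^ 3 * (1 - t ^ 4)⁻¹) := by
    refine ((((hg 1).mul_left _).sub ((hg 2).mul_left _)).add ((hg 3).mul_left _)).congr_fun ?_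
    intro i
    rw [offDiagEntry_sq ht0 ht1 hr hrt]
    ring
  convert hasSum_norm_sq_jacobiOp_basisVec (summable_offDiagEntry ht0 ht1 hr hrt)
    (summable_diagEntry ht0 ht1) hA hB using 1
  have h1 := (one_sub_pow_pos ht0 ht1 1).ne'
  have h2 := (one_sub_pow_pos ht0 ht1 2).ne'
  have h3 := (one_sub_pow_pos ht0 ht1 3).ne'
  simp only [Nat.reduceAdd] at h1 h2 h3
  field_simp
  ring

/-- The Jacobi operator of the symmetrized birth-death chain. -/
def birthDeathOp (t r : ℝ) : SqSum →L[ℂ] SqSum := jacobiOp (offDiagEntry t r) (diagEntry t r)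

theorem birthDeathOp_injective (ht0 : 0 < t) (ht1 : t < 1) (hr : 0 < r) (hrt : r * t ≤ 1 / 2)
    {v : SqSum} (hv : birthDeathOp t r v = 0) : v = 0 := by
  have ha := summable_offDiagEntry ht0 ht1 hr hrt
  have hb := summable_diagEntry (r := r) ht0 ht1
  have hapos := offDiagEntry_pos ht0 ht1 hr hrt
  have hstep (i : ℕ) : (offDiagEntry t r i : ℂ) * v (i + 1) =
      -((t ^ i * (1 - r * t ^ (i + 1)) : ℝ) : ℂ) * v i := by
    induction i with
    | zero =>
      have h := jacobiOp_apply_zero ha hb v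
      rw [show jacobiOp (offDiagEntry t r) (diagEntry t r) v = 0 from hv] at h
      simp only [diagEntry_eq, lp.coeFn_zero, Pi.zero_apply] at h
      push_cast at h ⊢
      linear_combination -h
    | succ i ih =>
      have h := jacobiOp_apply_succ ha hb v i
      rw [show jacobiOp (offDiagEntry t r) (diagEntry t r) v = 0 from hv] at h
      simp only [diagEntry_eq, lp.coeFn_zero, Pi.zero_apply] at h
      have hsq : (offDiagEntry t r i : ℂ) ^ 2 =
          ((r * t ^ (2 * i + 1) * ((1 - t ^ (i + 1)) * (1 - r * t ^ (i + 1))) : ℝ) : ℂ) := by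
        rw [← Complex.ofReal_pow, offDiagEntry_sq ht0 ht1 hr hrt]
      have hne : ((t ^ i * (1 - r * t ^ (i + 1)) : ℝ) : ℂ) ≠ 0 := by
        have h2 := mul_pow_succ_le ht0 ht1 hr hrt i
        have h3 : 0 < 1 - r * t ^ (i + 1) := by linarith
        exact Complex.ofReal_ne_zero.2 (by positivity)
      have hprev : (offDiagEntry t r i : ℂ) * v i =
          -((r * t ^ (i + 1) * (1 - t ^ (i + 1)) : ℝ) : ℂ) * v (i + 1) := by
        refine mul_left_cancel₀ hne ?_
        push_cast at ih hsq ⊢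
        linear_combination (offDiagEntry t r i : ℂ) * ih - v (i + 1) * hsq
      push_cast at h hprev ⊢
      linear_combination -h - hprev
  have hmono : Monotone fun i => ‖v i‖ := by
    refine monotone_nat_of_le_succ fun i => ?_
    have h := congrArg norm (hstep i)
    have h2 := mul_pow_succ_le ht0 ht1 hr hrt i
    have h3 : 0 < t ^ i * (1 - r * t ^ (i + 1)) := by
      have : 0 < 1 - r * t ^ (i + 1) := by linarith
      positivity
    rw [norm_mul, norm_mul, norm_neg, Complex.norm_real, Complex.norm_real,
      Real.norm_of_nonneg (hapos i).le, Real.norm_of_nonneg h3.le] at h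
    have hle : offDiagEntry t r i ≤ t ^ i * (1 - r * t ^ (i + 1)) := by
      refine Real.sqrt_le_iff.2 ⟨h3.le, ?_⟩
      have h4 : r * t * (1 - t ^ (i + 1)) ≤ 1 - r * t ^ (i + 1) := by
        have : 0 < r * t * t ^ (i + 1) := by positivity
        linarith
      have h5 : 0 < 1 - r * t ^ (i + 1) := by linarith
      calc r * t ^ (2 * i + 1) * ((1 - t ^ (i + 1)) * (1 - r * t ^ (i + 1)))
          = (t ^ i) ^ 2 * (1 - r * t ^ (i + 1)) * (r * t * (1 - t ^ (i + 1))) := by ring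
        _ ≤ (t ^ i) ^ 2 * (1 - r * t ^ (i + 1)) * (1 - r * t ^ (i + 1)) := by gcongr
        _ = (t ^ i * (1 - r * t ^ (i + 1))) ^ 2 := by ring
    refine le_of_mul_le_mul_left ?_ (hapos i)
    calc offDiagEntry t r i * ‖v i‖ ≤ t ^ i * (1 - r * t ^ (i + 1)) * ‖v i‖ := by gcongr
      _ = offDiagEntry t r i * ‖v (i + 1)‖ := h.symm
  have hlim : Tendsto (fun i => ‖v i‖) atTop (𝓝 0) := by
    have h := (lp.hasSum_norm (by norm_num) v).summable.tendsto_atTop_zero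
    simp only [ENNReal.toReal_ofNat, Real.rpow_ofNat] at h
    have h' := h.sqrt
    simpa [Real.sqrt_sq] using h'
  ext i
  simpa using hmono.ge_of_tendsto hlim i

theorem sqrtWeight_succ_mul (ht0 : 0 < t) (ht1 : t < 1) (hr : 0 < r) (hrt : r * t ≤ 1 / 2)
    (n : ℕ) : sqrtWeight t r (n + 1) * ((1 - t ^ (n + 1)) * (1 - r * t ^ (n + 1))) =
      offDiagEntry t r n * sqrtWeight t r n := by
  have h1 := (one_sub_pow_pos ht0 ht1 n).ne'
  have h2 := mul_pow_succ_le ht0 ht1 hr hrt n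
  have h3 : 1 - r * t ^ (n + 1) ≠ 0 := by linarith
  rw [sqrtWeight, prod_range_succ, ← sqrtWeight, mul_assoc,
    div_mul_cancel₀ _ (mul_ne_zero h1 h3), mul_comm]

theorem offDiagEntry_mul_sqrtWeight_succ (ht0 : 0 < t) (ht1 : t < 1) (hr : 0 < r)
    (hrt : r * t ≤ 1 / 2) (n : ℕ) :
    offDiagEntry t r n * sqrtWeight t r (n + 1) = r * t ^ (2 * n + 1) * sqrtWeight t r n := by
  have h1 := (one_sub_pow_pos ht0 ht1 n).ne'
  have h2 := mul_pow_succ_le ht0 ht1 hr hrt n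
  have h3 : 1 - r * t ^ (n + 1) ≠ 0 := by linarith
  refine mul_right_cancel₀ (mul_ne_zero h1 h3) ?_
  rw [mul_assoc, sqrtWeight_succ_mul ht0 ht1 hr hrt, ← mul_assoc, ← sq,
    offDiagEntry_sq ht0 ht1 hr hrt]
  ring

theorem sqrtWeight_pos (ht0 : 0 < t) (ht1 : t < 1) (hr : 0 < r) (hrt : r * t ≤ 1 / 2)
    (n : ℕ) : 0 < sqrtWeight t r n := by
  refine prod_pos fun i _ => ?_
  have h1 := one_sub_pow_pos ht0 ht1 i
  have h2 := mul_pow_succ_le ht0 ht1 hr hrt i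
  have h3 : 0 < 1 - r * t ^ (i + 1) := by linarith
  have h4 := offDiagEntry_pos ht0 ht1 hr hrt i
  positivity

theorem summable_sqrtWeight_mul_pow (ht0 : 0 < t) (ht1 : t < 1) (hr : 0 < r)
    (hrt : r * t ≤ 1 / 2) {c : ℝ} (hc : 0 < c) :
    Summable fun i => sqrtWeight t r i * c ^ i := by
  have hw := sqrtWeight_pos ht0 ht1 hr hrt
  have hlim : Tendsto (fun i => offDiagEntry t r i /
      ((1 - t ^ (i + 1)) * (1 - r * t ^ (i + 1))) * c) atTop (𝓝 (0 / ((1 - 0) * (1 - r * 0)) * c)) := by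
    have ht : Tendsto (fun i => t ^ (i + 1)) atTop (𝓝 0) :=
      (tendsto_pow_atTop_nhds_zero_of_lt_one ht0.le ht1).comp (tendsto_add_atTop_nat 1)
    exact ((summable_offDiagEntry ht0 ht1 hr hrt).tendsto_atTop_zero.div
      ((tendsto_const_nhds.sub ht).mul (tendsto_const_nhds.sub (ht.const_mul r)))
        (by norm_num)).mul_const c
  refine summable_of_ratio_test_tendsto_lt_one (l := 0) one_pos
    (Eventually.of_forall fun i => (mul_pos (hw i) (pow_pos hc i)).ne') ?_
  convert hlim using 1
  · ext i
    rw [Real.norm_of_nonneg (mul_pos (hw _) (pow_pos hc _)).le,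
      Real.norm_of_nonneg (mul_pos (hw _) (pow_pos hc _)).le, sqrtWeight, prod_range_succ,
      ← sqrtWeight]
    have h1 := (hw i).ne'
    field_simp
    ring
  · norm_num

theorem summable_sqrtWeight_mul_eigenPoly (ht0 : 0 < t) (ht1 : t < 1) (hr : 0 < r)
    (hrt : r * t ≤ 1 / 2) (k : ℕ) :
    Summable fun i => sqrtWeight t r i * eigenPoly t r k (t⁻¹ ^ i) := by
  have h (m : ℕ) : Summable fun i => sqrtWeight t r i * pochProd t m (t⁻¹ ^ i) := by
    refine .of_norm_bounded
      ((summable_sqrtWeight_mul_pow ht0 ht1 hr hrt (c := t⁻¹ ^ m) (by positivity)).mul_left (2 ^ m))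
      fun i => ?_
    rw [norm_mul, Real.norm_of_nonneg (sqrtWeight_pos ht0 ht1 hr hrt i).le, Real.norm_eq_abs]
    calc sqrtWeight t r i * |pochProd t m (t⁻¹ ^ i)|
        ≤ sqrtWeight t r i * (2 * t⁻¹ ^ i) ^ m :=
          mul_le_mul_of_nonneg_left
            (abs_pochProd_le ht0 ht1 (one_le_pow₀ ((one_le_inv₀ ht0).2 ht1.le)) m)
            (sqrtWeight_pos ht0 ht1 hr hrt i).le
      _ = 2 ^ m * (sqrtWeight t r i * (t⁻¹ ^ m) ^ i) := by
          rw [mul_pow, ← pow_mul, ← pow_mul, mul_comm i m]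
          ring
  have h' := summable_sum fun m (_ : m ∈ range (k + 1)) => (h m).mul_left (eigenCoeff t r k m)
  refine h'.congr fun i => ?_
  rw [eigenPoly, mul_sum]
  exact sum_congr rfl fun m _ => by ring

theorem hasEigenvalue_birthDeathOp_pow (ht0 : 0 < t) (ht1 : t < 1) (hr : 0 < r)
    (hrt : r * t ≤ 1 / 2) (k : ℕ) :
    Module.End.HasEigenvalue (birthDeathOp t r : SqSum →ₗ[ℂ] SqSum) ((t : ℂ) ^ k) := by
  have ha := summable_offDiagEntry ht0 ht1 hr hrt
  have hb := summable_diagEntry (r := r) ht0 ht1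
  have hmem : Memℓp (fun i => ((sqrtWeight t r i * eigenPoly t r k (t⁻¹ ^ i) : ℝ) : ℂ)) 2 := by
    refine Memℓp.of_exponent_ge (p := 2) (q := 1) (memℓp_gen ?_) one_le_two
    simpa only [ENNReal.toReal_one, Real.rpow_one, Complex.norm_real] using
      (summable_sqrtWeight_mul_eigenPoly ht0 ht1 hr hrt k).norm
  let v : SqSum := ⟨_, hmem⟩
  have hv (i : ℕ) : v i = ((sqrtWeight t r i * eigenPoly t r k (t⁻¹ ^ i) : ℝ) : ℂ) := rfl
  refine Module.End.hasEigenvalue_of_hasEigenvector (x := v)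
    ⟨Module.End.mem_eigenspace_iff.2 ?_, fun h => ?_⟩
  · ext i
    change birthDeathOp t r v i = (t : ℂ) ^ k * v i
    rcases i with _ | i
    · have hrec := eigenPoly_birthDeath ht0 ht1 hr one_ne_zero k
      have hw := offDiagEntry_mul_sqrtWeight_succ ht0 ht1 hr hrt 0
      have hreal : diagEntry t r 0 * (sqrtWeight t r 0 * eigenPoly t r k (t⁻¹ ^ 0)) +
          offDiagEntry t r 0 * (sqrtWeight t r 1 * eigenPoly t r k (t⁻¹ ^ 1)) =
            t ^ k * (sqrtWeight t r 0 * eigenPoly t r k (t⁻¹ ^ 0)) := by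
        rw [diagEntry]
        simp only [one_div, pow_zero, pow_one, zero_add, mul_zero, one_pow, div_one,
          sub_self, zero_mul, add_zero, sub_zero] at hrec hw ⊢
        linear_combination eigenPoly t r k t⁻¹ * hw + sqrtWeight t r 0 * hrec
      have hC := congrArg Complex.ofReal hreal
      rw [birthDeathOp, jacobiOp_apply_zero ha hb, hv, hv]
      push_cast at hC ⊢
      exact hC
    · have hz : t⁻¹ ^ (i + 1) ≠ 0 := by positivity
      have hrec := eigenPoly_birthDeath ht0 ht1 hr hz k
      have hw := offDiagEntry_mul_sqrtWeight_succ ht0 ht1 hr hrt (i + 1)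
      have hw' := sqrtWeight_succ_mul ht0 ht1 hr hrt i
      have e1 : t⁻¹ ^ (i + 1) / t = t⁻¹ ^ (i + 2) := by rw [pow_succ _ (i + 1), div_eq_mul_inv]
      have e2 : t⁻¹ ^ (i + 1) * t = t⁻¹ ^ i := by
        rw [pow_succ, mul_assoc, inv_mul_cancel₀ ht0.ne', mul_one]
      have e3 : r * t / (t⁻¹ ^ (i + 1)) ^ 2 = r * t ^ (2 * (i + 1) + 1) := by
        rw [inv_pow, inv_pow, div_inv_eq_mul]
        ring
      have e4 (x : ℝ) : x / t⁻¹ ^ (i + 1) = x * t ^ (i + 1) := by rw [inv_pow, div_inv_eq_mul]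
      rw [e1, e2, e3, e4, e4, one_mul] at hrec
      have hreal : offDiagEntry t r i * (sqrtWeight t r i * eigenPoly t r k (t⁻¹ ^ i)) +
          diagEntry t r (i + 1) * (sqrtWeight t r (i + 1) * eigenPoly t r k (t⁻¹ ^ (i + 1))) +
          offDiagEntry t r (i + 1) * (sqrtWeight t r (i + 2) * eigenPoly t r k (t⁻¹ ^ (i + 2))) =
            t ^ k * (sqrtWeight t r (i + 1) * eigenPoly t r k (t⁻¹ ^ (i + 1))) := by
        rw [diagEntry]
        linear_combination eigenPoly t r k (t⁻¹ ^ (i + 2)) * hw -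
          eigenPoly t r k (t⁻¹ ^ i) * hw' + sqrtWeight t r (i + 1) * hrec
      have hC := congrArg Complex.ofReal hreal
      rw [birthDeathOp, jacobiOp_apply_succ ha hb, hv, hv, hv]
      push_cast at hC ⊢
      exact hC
  · have h0 := hv 0
    rw [h, pow_zero, eigenPoly_one] at h0
    simp [sqrtWeight] at h0

theorem hasEigenvalue_birthDeathOp_iff (ht0 : 0 < t) (ht1 : t < 1) (hr : 0 < r)
    (hrt : r * t ≤ 1 / 2) (μ : ℂ) :
    Module.End.HasEigenvalue (birthDeathOp t r : SqSum →ₗ[ℂ] SqSum) μ ↔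
      ∃ k : ℕ, μ = (t : ℂ) ^ k := by
  refine ⟨fun hμ => ?_, ?_⟩
  · by_contra! hne
    have hμ0 : μ ≠ 0 := by
      rintro rfl
      obtain ⟨v, hv⟩ := hμ.exists_hasEigenvector
      refine hv.2 (birthDeathOp_injective ht0 ht1 hr hrt ?_)
      simpa using hv.apply_eq_smul
    have hinj : Function.Injective fun k : ℕ => (t : ℂ) ^ k := by
      intro k l h
      exact pow_right_injective₀ ht0 ht1.ne (Complex.ofReal_injective (by simpa using h))
    have hle (N : ℕ) : ‖μ‖ ^ 2 + ∑ k ∈ range N, (t ^ 2) ^ k ≤ (1 - t ^ 2)⁻¹ := by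
      have h := sum_norm_sq_eigenvalues_le
        (isSelfAdjoint_jacobiOp (summable_offDiagEntry ht0 ht1 hr hrt) (summable_diagEntry ht0 ht1))
        (hasSum_norm_sq_birthDeath ht0 ht1 hr hrt)
        (insert μ ((range N).image fun k : ℕ => (t : ℂ) ^ k)) ?_
      · rw [sum_insert (by simpa using fun k _ => (hne k).symm), sum_image hinj.injOn] at h
        convert h using 3 with k
        rw [norm_pow, Complex.norm_real, Real.norm_of_nonneg ht0.le, ← pow_mul, ← pow_mul,
          mul_comm]
      · intro ν hν
        obtain rfl | hν := Finset.mem_insert.1 hν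
        · exact hμ
        · obtain ⟨k, -, rfl⟩ := Finset.mem_image.1 hν
          exact hasEigenvalue_birthDeathOp_pow ht0 ht1 hr hrt k
    have hg := (hasSum_geometric_of_lt_one (sq_nonneg t)
      (pow_lt_one₀ ht0.le ht1 two_ne_zero)).tendsto_sum_nat
    have := le_of_tendsto' (hg.const_add (‖μ‖ ^ 2)) hle
    have hpos : 0 < ‖μ‖ ^ 2 := by positivity
    linarith
  · rintro ⟨k, rfl⟩
    exact hasEigenvalue_birthDeathOp_pow ht0 ht1 hr hrt k

theorem birthDeath_spectrum (ht0 : 0 < t) (ht1 : t < 1) (hr : 0 < r) (hrt : r * t ≤ 1 / 2)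
    {P : ℕ → ℕ → ℝ} {w : ℕ → ℝ} (hw : ∀ i, 0 < w i)
    (hup : ∀ i, P i (i + 1) = r * t ^ (2 * i + 1))
    (hdown : ∀ i, P (i + 1) i = (1 - t ^ (i + 1)) * (1 - r * t ^ (i + 1)))
    (hdiag : ∀ i, P i i = diagEntry t r i)
    (hzero : ∀ i j, j ≠ i + 1 → j ≠ i → i ≠ j + 1 → P i j = 0)
    (hrev : ∀ i, w i * P i (i + 1) = w (i + 1) * P (i + 1) i) :
    ∃ T : SqSum →L[ℂ] SqSum,
      (∀ (f : SqSum) (j : ℕ),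
        T f j = ∑' i : ℕ, f i * ((P i j * Real.sqrt (w i / w j) : ℝ) : ℂ)) ∧
      Summable (fun k : ℕ => ‖T (lp.single 2 k 1)‖ ^ 2) ∧
      IsCompactOperator T ∧ IsSelfAdjoint T ∧
      (∀ μ : ℂ, Module.End.HasEigenvalue (T : SqSum →ₗ[ℂ] SqSum) μ ↔
        ∃ k : ℕ, μ = (t : ℂ) ^ k) := by
  have ha := summable_offDiagEntry ht0 ht1 hr hrt
  have hb := summable_diagEntry (r := r) ht0 ht1
  have hdiag' (i : ℕ) : P i i * √(w i / w i) = diagEntry t r i := by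
    rw [div_self (hw i).ne', Real.sqrt_one, mul_one, hdiag]
  have hpos (i : ℕ) : 0 < (1 - t ^ (i + 1)) * (1 - r * t ^ (i + 1)) := by
    have h2 := mul_pow_succ_le ht0 ht1 hr hrt i
    exact mul_pos (one_sub_pow_pos ht0 ht1 i) (by linarith)
  have hup' (i : ℕ) : P i (i + 1) * √(w i / w (i + 1)) = offDiagEntry t r i := by
    have h1 := hpos i
    have h2 : 0 < r * t ^ (2 * i + 1) := by positivity
    have h3 := hrev i
    have h4 := hw i
    have h5 := hw (i + 1)
    rw [hup, hdown] at h3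
    rw [hup, offDiagEntry, ← Real.sqrt_sq h2.le, ← Real.sqrt_mul (sq_nonneg _)]
    congr 1
    rw [Real.sqrt_sq h2.le]
    field_simp
    linear_combination h3
  have hdown' (i : ℕ) : P (i + 1) i * √(w (i + 1) / w i) = offDiagEntry t r i := by
    have h1 := hpos i
    have h3 := hrev i
    have h4 := hw i
    have h5 := hw (i + 1)
    rw [hup, hdown] at h3
    rw [hdown, offDiagEntry, ← Real.sqrt_sq h1.le, ← Real.sqrt_mul (sq_nonneg _)]
    congr 1
    rw [Real.sqrt_sq h1.le, sq, mul_assoc, mul_comm (r * t ^ (2 * i + 1))]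
    congr 1
    rw [mul_div_assoc', div_eq_iff h4.ne']
    linear_combination -h3
  refine ⟨birthDeathOp t r, fun f j => ?_, (hasSum_norm_sq_birthDeath ht0 ht1 hr hrt).summable,
    isCompactOperator_jacobiOp ha hb, isSelfAdjoint_jacobiOp ha hb,
    hasEigenvalue_birthDeathOp_iff ht0 ht1 hr hrt⟩
  rcases j with _ | j
  · rw [tsum_eq_sum (s := range 2), sum_range_succ, sum_range_one, hdiag', hdown', birthDeathOp,
      jacobiOp_apply_zero ha hb]
    · ring
    · intro i hi
      rw [Finset.mem_range] at hi
      rw [hzero i 0 (by omega) (by omega) (by omega)]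
      simp
  · rw [tsum_eq_sum (s := {j, j + 1, j + 2}), sum_insert (by simp), sum_pair (by omega), hup',
      hdiag', hdown', birthDeathOp, jacobiOp_apply_succ ha hb]
    · ring
    · intro i hi
      simp only [Finset.mem_insert, Finset.mem_singleton, not_or] at hi
      rw [hzero i (j + 1) (by omega) (by omega) (by omega)]
      simp

end Parameters

theorem etaF_pos {q : ℝ} (hq : 1 < q) (k : ℕ) : 0 < etaF q k :=
  prod_pos fun i _ => one_sub_pow_pos (inv_pos.2 (by linarith)) (inv_lt_one_of_one_lt₀ hq) i

theorem etaF_succ (q : ℝ) (k : ℕ) : etaF q (k + 1) = etaF q k * (1 - q⁻¹ ^ (k + 1)) :=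
  prod_range_succ _ _

theorem alphaQ_pos {q : ℝ} (hq : 1 < q) : 0 < alphaQ q := by
  have h0 : 0 < q⁻¹ := inv_pos.2 (by linarith)
  have h1 : q⁻¹ < 1 := inv_lt_one_of_one_lt₀ hq
  have hs : Summable fun i : ℕ => -q⁻¹ ^ (2 * i + 1) := by
    refine Summable.neg ?_
    refine ((summable_geometric_of_lt_one (sq_nonneg q⁻¹)
      (pow_lt_one₀ h0.le h1 two_ne_zero)).mul_left q⁻¹).congr fun i => ?_
    rw [← pow_mul, pow_succ']
  rw [alphaQ, ← Real.rexp_tsum_eq_tprod (fun i => one_sub_pow_pos h0 h1 (2 * i))]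
  · exact Real.exp_pos _
  · simpa only [← sub_eq_add_neg] using Real.summable_log_one_add_of_summable hs

theorem piAlt_pos {q : ℝ} (hq : 1 < q) (j : ℕ) : 0 < piAlt q j := by
  have h0 : 0 < q := by linarith
  exact div_pos (alphaQ_pos hq) (mul_pos (pow_pos h0 _) (etaF_pos hq _))

theorem piAlt'_pos {q : ℝ} (hq : 1 < q) (j : ℕ) : 0 < piAlt' q j := by
  have h0 : 0 < q := by linarith
  exact div_pos (alphaQ_pos hq) (mul_pos (pow_pos h0 _) (etaF_pos hq _))

theorem piAlt_reversible {q : ℝ} (hq : 1 < q) (i : ℕ) :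
    piAlt q i * q⁻¹ ^ (4 * i + 3) =
      piAlt q (i + 1) * ((1 - q⁻¹ ^ (2 * i + 2)) * (1 - q⁻¹ ^ (2 * i + 3))) := by
  have h0 : q ≠ 0 := by positivity
  have h1 := (etaF_pos hq (2 * i + 1)).ne'
  have hinv : 0 < q⁻¹ := inv_pos.2 (by linarith)
  have h2 := (one_sub_pow_pos hinv (inv_lt_one_of_one_lt₀ hq) (2 * i + 1)).ne'
  have h3 := (one_sub_pow_pos hinv (inv_lt_one_of_one_lt₀ hq) (2 * i + 2)).ne'
  have e : 2 * (i + 1) ^ 2 + (i + 1) = (2 * i ^ 2 + i) + (4 * i + 3) := by ring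
  rw [piAlt, piAlt, e, pow_add q (2 * i ^ 2 + i) (4 * i + 3),
    show 2 * (i + 1) + 1 = 2 * i + 1 + 1 + 1 by ring, etaF_succ q (2 * i + 1 + 1),
    etaF_succ q (2 * i + 1)]
  simp only [add_assoc, Nat.reduceAdd] at h1 h2 h3 ⊢
  generalize 1 - q⁻¹ ^ (2 * i + 2) = x at *
  generalize 1 - q⁻¹ ^ (2 * i + 3) = y at *
  rw [inv_pow]
  field_simp

theorem piAlt'_reversible {q : ℝ} (hq : 1 < q) (i : ℕ) :
    piAlt' q i * q⁻¹ ^ (4 * i + 1) =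
      piAlt' q (i + 1) * ((1 - q⁻¹ ^ (2 * i + 2)) * (1 - q⁻¹ ^ (2 * i + 1))) := by
  have h0 : q ≠ 0 := by positivity
  have h1 := (etaF_pos hq (2 * i)).ne'
  have hinv : 0 < q⁻¹ := inv_pos.2 (by linarith)
  have h2 := (one_sub_pow_pos hinv (inv_lt_one_of_one_lt₀ hq) (2 * i)).ne'
  have h3 := (one_sub_pow_pos hinv (inv_lt_one_of_one_lt₀ hq) (2 * i + 1)).ne'
  have e : 2 * (i + 1) ^ 2 - (i + 1) = (2 * i ^ 2 - i) + (4 * i + 1) := by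
    have : i ≤ 2 * i ^ 2 := by nlinarith [Nat.le_self_pow two_ne_zero i]
    have e' : 2 * (i + 1) ^ 2 = 2 * i ^ 2 + 4 * i + 2 := by ring
    omega
  rw [piAlt', piAlt', e, pow_add q, show 2 * (i + 1) = 2 * i + 1 + 1 by ring, etaF_succ,
    etaF_succ]
  simp only [add_assoc, Nat.reduceAdd] at h1 h2 h3 ⊢
  generalize 1 - q⁻¹ ^ (2 * i + 2) = x at *
  generalize 1 - q⁻¹ ^ (2 * i + 1) = y at *
  rw [inv_pow]
  field_simp

/-- For every prime power `q`, the operators `μ ↦ μP_alt` on `ℓ²(π_alt)` and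
`μ ↦ μQ_alt` on `ℓ²(π'_alt)` (realized on standard `ℓ²(ℕ,ℂ)` via the usual isometries) are
Hilbert–Schmidt (in particular compact) and self-adjoint, and both eigenvalue sets are exactly
`{q^{−2k} : k ≥ 0}`. -/
theorem stmt14 (q : ℕ) (hq : IsPrimePow q) :
    (∃ T : lp (fun _ : ℕ => ℂ) 2 →L[ℂ] lp (fun _ : ℕ => ℂ) 2,
      (∀ (f : lp (fun _ : ℕ => ℂ) 2) (j : ℕ),
        T f j = ∑' i : ℕ,
          f i * ((Palt q i j * Real.sqrt (piAlt q i / piAlt q j) : ℝ) : ℂ)) ∧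
      Summable (fun k : ℕ => ‖T (lp.single 2 k 1)‖ ^ 2) ∧
      IsCompactOperator T ∧
      IsSelfAdjoint T ∧
      (∀ μ : ℂ,
        Module.End.HasEigenvalue
            (T : lp (fun _ : ℕ => ℂ) 2 →ₗ[ℂ] lp (fun _ : ℕ => ℂ) 2) μ
          ↔ ∃ k : ℕ, μ = ((q : ℂ))⁻¹ ^ (2 * k))) ∧
    (∃ T : lp (fun _ : ℕ => ℂ) 2 →L[ℂ] lp (fun _ : ℕ => ℂ) 2,
      (∀ (f : lp (fun _ : ℕ => ℂ) 2) (j : ℕ),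
        T f j = ∑' i : ℕ,
          f i * ((Qalt q i j * Real.sqrt (piAlt' q i / piAlt' q j) : ℝ) : ℂ)) ∧
      Summable (fun k : ℕ => ‖T (lp.single 2 k 1)‖ ^ 2) ∧
      IsCompactOperator T ∧
      IsSelfAdjoint T ∧
      (∀ μ : ℂ,
        Module.End.HasEigenvalue
            (T : lp (fun _ : ℕ => ℂ) 2 →ₗ[ℂ] lp (fun _ : ℕ => ℂ) 2) μ
          ↔ ∃ k : ℕ, μ = ((q : ℂ))⁻¹ ^ (2 * k))) := by
  have hq2 : (2 : ℝ) ≤ q := by exact_mod_cast hq.two_le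
  have hq1 : (1 : ℝ) < q := by linarith
  have hq0 : (q : ℝ) ≠ 0 := by positivity
  have hinv0 : 0 < (q : ℝ)⁻¹ := by positivity
  have hinv : (q : ℝ)⁻¹ ≤ 1 / 2 := by
    rw [one_div]
    exact inv_anti₀ two_pos hq2
  have ht0 : 0 < (q : ℝ)⁻¹ ^ 2 := by positivity
  have ht1 : (q : ℝ)⁻¹ ^ 2 < 1 := by nlinarith
  have hpow (k : ℕ) : (((q : ℝ)⁻¹ ^ 2 : ℝ) : ℂ) ^ k = (q : ℂ)⁻¹ ^ (2 * k) := by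
    push_cast
    rw [pow_mul]
  have hcancel (i : ℕ) : (q : ℝ) * ((q : ℝ)⁻¹ ^ 2) ^ (i + 1) = (q : ℝ)⁻¹ ^ (2 * i + 1) := by
    rw [← pow_mul, show 2 * (i + 1) = 2 * i + 1 + 1 by ring, pow_succ']
    exact mul_inv_cancel_left₀ hq0 _
  constructor
  · simp only [← hpow]
    refine birthDeath_spectrum (r := (q : ℝ)⁻¹) ht0 ht1 hinv0 (by nlinarith) (piAlt_pos hq1)
      (fun i => ?_) (fun i => ?_) (fun i => ?_) (fun i j h1 h2 h3 => ?_) (fun i => ?_)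
    · rw [Palt, if_pos rfl]
      ring
    · rw [Palt, if_neg (by omega), if_neg (by omega), if_pos rfl]
      ring
    · rw [Palt, if_neg (by omega), if_pos rfl, diagEntry]
      ring
    · rw [Palt, if_neg h1, if_neg h2, if_neg h3]
    · rw [Palt, Palt, if_pos rfl, if_neg (by omega), if_neg (by omega), if_pos rfl]
      exact piAlt_reversible hq1 i
  · simp only [← hpow]
    refine birthDeath_spectrum (r := (q : ℝ)) ht0 ht1 (by positivity) ?_ (piAlt'_pos hq1)
      (fun i => ?_) (fun i => ?_) (fun i => ?_) (fun i j h1 h2 h3 => ?_) (fun i => ?_)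
    · simpa using (hcancel 0).le.trans (by simpa using hinv)
    · rw [Qalt, if_pos rfl, hcancel]
      congr 1
      ring
    · rw [Qalt, if_neg (by omega), if_neg (by omega), if_pos rfl, hcancel, ← pow_mul]
      rfl
    · rw [Qalt, if_neg (by omega), if_pos rfl, diagEntry, hcancel]
      rcases i with _ | i
      · simp
      · rw [hcancel, ← pow_mul, show 2 * (2 * (i + 1)) = 4 * (i + 1) by ring]
        rfl
    · rw [Qalt, if_neg h1, if_neg h2, if_neg h3]
    · rw [Qalt, Qalt, if_pos rfl, if_neg (by omega), if_neg (by omega), if_pos rfl]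
      exact piAlt'_reversible hq1 i
end
end

section
/- For every odd prime power q and every integer n ≥ 1, |‖δ₀P_Her^n − π_Her‖_tv − (2β(q)/((q+1)·α(q²)))·q^{−n}| ≤ (β(q)^{−2} − 1)^{1/2} · q^{−2n}, where α(q²) := ∏_{i≥1, i odd}(1 − q^{−2i}). -/
noncomputable section

/-- The transition matrix `P_Her` (Hermitian matrices). -/
def PHer (q : ℝ) (i j : ℕ) : ℝ :=
  if j = i + 1 then q⁻¹ ^ (2 * i + 1)
  else if j = i then q⁻¹ ^ (2 * i) * (1 - q⁻¹)
  else if i = j + 1 then 1 - q⁻¹ ^ (2 * i)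
  else 0

/-- `β(q) = ∏_{i ≥ 1, i odd} (1 + q^{-i})^{-1}`. -/
def betaQ (q : ℝ) : ℝ := ∏' i : ℕ, (1 + q⁻¹ ^ (2 * i + 1))⁻¹

/-- `π_Her(j) = β(q)/(q^{j²}·η_j(q²))`, where `η_j(q²) = ∏_{i=1}^{j}(1 − q^{-2i})`. -/
def piHer (q : ℝ) (j : ℕ) : ℝ :=
  betaQ q / (q ^ (j ^ 2) * ∏ i ∈ Finset.range j, (1 - q⁻¹ ^ (2 * (i + 1))))

/-- `α(q²) = ∏_{i ≥ 1, i odd} (1 − q^{-2i})`. -/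
def alphaQsq (q : ℝ) : ℝ := ∏' i : ℕ, (1 - q⁻¹ ^ (2 * (2 * i + 1)))

/-- The action `μ ↦ μP`, `(μP)(j) = Σ_i μ(i)P(i,j)`. -/
def applyP (P : ℕ → ℕ → ℝ) (μ : ℕ → ℝ) : ℕ → ℝ := fun j => ∑' i : ℕ, μ i * P i j

/-- `δ₀`. -/
def delta0 : ℕ → ℝ := fun i => if i = 0 then 1 else 0

open Filter Topology Finset

/-! ### Infinite products and an identity of Euler -/

lemma tendsto_prod_range_one_add {f : ℕ → ℝ} (hf : Summable f) :
    Tendsto (fun n => ∏ i ∈ range n, (1 + f i)) atTop (𝓝 (∏' i, (1 + f i))) :=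
  (Real.multipliable_one_add_of_summable hf).tendsto_prod_tprod_nat

lemma tprod_inv_one_add {f : ℕ → ℝ} (hf : Summable f) (h0 : ∀ i, 1 + f i ≠ 0) :
    ∏' i, (1 + f i)⁻¹ = (∏' i, (1 + f i))⁻¹ := by
  have hne := tprod_one_add_ne_zero_of_summable h0 hf.norm
  have h : HasProd (fun i => (1 + f i)⁻¹) (∏' i, (1 + f i))⁻¹ := by
    have := (Real.multipliable_one_add_of_summable hf).hasProd
    unfold HasProd at this ⊢
    simpa only [Finset.prod_inv_distrib] using this.inv₀ hne
  exact h.tprod_eq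

lemma summable_pow_affine {x : ℝ} (hx0 : 0 < x) (hx1 : x < 1) {a : ℕ} (ha : 1 ≤ a) (b : ℕ) :
    Summable fun i : ℕ => x ^ (a * i + b) := by
  have h : Summable fun i : ℕ => (x ^ a) ^ i * x ^ b :=
    (summable_geometric_of_lt_one (by positivity)
      (pow_lt_one₀ hx0.le hx1 (by omega))).mul_right _
  simpa only [pow_add, pow_mul] using h

/-- The coefficients `x^{j²} / ∏_{i=1}^{j} (1 - x^{2i})` of Euler's product
`∏_{i ≥ 0} (1 + z x^{2i+1})`. -/
def eulerCoeff (x : ℝ) (j : ℕ) : ℝ :=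
  x ^ (j ^ 2) / ∏ i ∈ range j, (1 - x ^ (2 * (i + 1)))

/-- The power series with coefficients `eulerCoeff x`. -/
def eulerSeries (x z : ℝ) : ℝ := ∑' j : ℕ, eulerCoeff x j * z ^ j

section Euler

variable {x : ℝ} (hx0 : 0 < x) (hx1 : x < 1)
include hx0 hx1

lemma one_sub_pow_pos_s17 {n : ℕ} (hn : n ≠ 0) : 0 < 1 - x ^ n :=
  sub_pos.2 (pow_lt_one₀ hx0.le hx1 hn)

lemma one_sub_neg_pow_ne_zero (n : ℕ) : 1 - (-x) ^ (n + 1) ≠ 0 := fun h => by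
  have h1 : |(-x) ^ (n + 1)| < 1 := by
    rw [abs_pow, abs_neg, abs_of_pos hx0]
    exact pow_lt_one₀ hx0.le hx1 (by omega)
  rw [← sub_eq_zero.1 h, abs_one] at h1
  exact lt_irrefl _ h1

lemma eulerCoeff_pos (j : ℕ) : 0 < eulerCoeff x j :=
  div_pos (by positivity) (prod_pos fun i _ => one_sub_pow_pos_s17 hx0 hx1 (by omega))

lemma eulerCoeff_succ (j : ℕ) :
    eulerCoeff x (j + 1) * (1 - x ^ (2 * (j + 1))) = x ^ (2 * j + 1) * eulerCoeff x j := by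
  have h1 := (one_sub_pow_pos_s17 hx0 hx1 (n := 2 * (j + 1)) (by omega)).ne'
  have h2 : ∏ i ∈ range j, (1 - x ^ (2 * (i + 1))) ≠ 0 :=
    (prod_pos fun i _ => one_sub_pow_pos_s17 hx0 hx1 (by omega)).ne'
  unfold eulerCoeff
  rw [prod_range_succ]
  field_simp
  rw [← pow_add]
  congr 1
  ring

lemma summable_eulerCoeff_mul_pow (z : ℝ) : Summable fun j => eulerCoeff x j * z ^ j := by
  refine summable_of_ratio_norm_eventually_le (r := 1 / 2) (by norm_num) ?_
  have ht : Tendsto (fun j : ℕ => x ^ (2 * j + 1) * |z|) atTop (𝓝 0) := by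
    have := (summable_pow_affine hx0 hx1 (a := 2) (by norm_num) 1).tendsto_atTop_zero
    simpa using this.mul_const |z|
  have hd : 0 < 1 - x ^ 2 := one_sub_pow_pos_s17 hx0 hx1 (by norm_num)
  filter_upwards [ht.eventually_le_const (show (0 : ℝ) < (1 - x ^ 2) / 2 by positivity)] with j hj
  have hc := eulerCoeff_pos hx0 hx1 j
  have hc' := eulerCoeff_pos hx0 hx1 (j + 1)
  have hs := eulerCoeff_succ hx0 hx1 j
  have hle : x ^ (2 * (j + 1)) ≤ x ^ 2 := pow_le_pow_of_le_one hx0.le hx1.le (by omega)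
  simp only [norm_mul, norm_pow, Real.norm_eq_abs, abs_of_pos hc, abs_of_pos hc', pow_succ |z|]
  have key : eulerCoeff x (j + 1) * |z| ≤ 1 / 2 * eulerCoeff x j := by
    refine le_of_mul_le_mul_right ?_ hd
    calc eulerCoeff x (j + 1) * |z| * (1 - x ^ 2)
        ≤ eulerCoeff x (j + 1) * |z| * (1 - x ^ (2 * (j + 1))) := by gcongr
      _ = x ^ (2 * j + 1) * |z| * eulerCoeff x j := by linear_combination |z| * hs
      _ ≤ (1 - x ^ 2) / 2 * eulerCoeff x j := by gcongr
      _ = _ := by ring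
  calc eulerCoeff x (j + 1) * (|z| ^ j * |z|) = |z| ^ j * (eulerCoeff x (j + 1) * |z|) := by ring
    _ ≤ |z| ^ j * (1 / 2 * eulerCoeff x j) := by gcongr
    _ = _ := by ring

lemma one_le_eulerSeries {z : ℝ} (hz : 0 ≤ z) : 1 ≤ eulerSeries x z := by
  have h := (summable_eulerCoeff_mul_pow hx0 hx1 z).le_tsum 0 fun j _ =>
    mul_nonneg (eulerCoeff_pos hx0 hx1 j).le (pow_nonneg hz j)
  have h0 : eulerCoeff x 0 * z ^ 0 = 1 := by simp [eulerCoeff]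
  exact h0 ▸ h

lemma eulerSeries_eq_mul (z : ℝ) :
    eulerSeries x z = (1 + z * x) * eulerSeries x (z * x ^ 2) := by
  have hs := summable_eulerCoeff_mul_pow hx0 hx1 z
  have hs' := summable_eulerCoeff_mul_pow hx0 hx1 (z * x ^ 2)
  have h : eulerSeries x z - eulerSeries x (z * x ^ 2) =
      z * x * eulerSeries x (z * x ^ 2) := by
    unfold eulerSeries
    rw [← hs.tsum_sub hs', (hs.sub hs').tsum_eq_zero_add, ← tsum_mul_left]
    simp only [pow_zero, sub_self, zero_add]
    refine tsum_congr fun j => ?_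
    have := eulerCoeff_succ hx0 hx1 j
    calc _ = eulerCoeff x (j + 1) * (1 - x ^ (2 * (j + 1))) * z ^ (j + 1) := by
          rw [pow_mul, mul_pow]; ring
      _ = _ := by rw [this, mul_pow, ← pow_mul]; ring
  linear_combination h

lemma eulerSeries_eq_prod_mul (z : ℝ) (n : ℕ) :
    eulerSeries x z =
      (∏ i ∈ range n, (1 + z * x ^ (2 * i + 1))) * eulerSeries x (z * x ^ (2 * n)) := by
  induction n with
  | zero => simp
  | succ n ih =>
    rw [ih, eulerSeries_eq_mul hx0 hx1 (z * x ^ (2 * n)), prod_range_succ]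
    ring_nf

lemma tendsto_eulerSeries (z : ℝ) :
    Tendsto (fun n : ℕ => eulerSeries x (z * x ^ (2 * n))) atTop (𝓝 1) := by
  have hlim : ∑' j : ℕ, (if j = 0 then (1 : ℝ) else 0) = 1 := by simp
  rw [← hlim]
  refine tendsto_tsum_of_dominated_convergence
    (summable_eulerCoeff_mul_pow hx0 hx1 |z|) (fun j => ?_) (Eventually.of_forall fun n j => ?_)
  · rcases j with _ | j
    · simp [eulerCoeff]
    · have h := (summable_pow_affine hx0 hx1 (a := 2) (by norm_num) 0).tendsto_atTop_zero
      have h2 := ((h.const_mul z).pow (j + 1)).const_mul (eulerCoeff x (j + 1))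
      simpa using h2
  · have hc := eulerCoeff_pos hx0 hx1 j
    have hp : x ^ (2 * n) ≤ 1 := pow_le_one₀ hx0.le hx1.le
    rw [norm_mul, Real.norm_eq_abs, abs_of_pos hc, norm_pow, norm_mul, Real.norm_eq_abs,
      Real.norm_eq_abs, abs_of_pos (pow_pos hx0 _)]
    gcongr
    exact mul_le_of_le_one_right (abs_nonneg z) hp

/-- Euler's identity `∑ x^{j²} z^j / ((1-x²)⋯(1-x^{2j})) = ∏ (1 + z x^{2i+1})`. -/
lemma tendsto_prod_eulerSeries (z : ℝ) :
    Tendsto (fun n => ∏ i ∈ range n, (1 + z * x ^ (2 * i + 1))) atTop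
      (𝓝 (eulerSeries x z)) := by
  have h1 := tendsto_eulerSeries hx0 hx1 z
  have h2 : Tendsto (fun n : ℕ => eulerSeries x z / eulerSeries x (z * x ^ (2 * n))) atTop
      (𝓝 (eulerSeries x z)) := by
    simpa [Pi.div_def] using (tendsto_const_nhds (x := eulerSeries x z)).div h1 one_ne_zero
  refine h2.congr' ?_
  filter_upwards [h1.eventually_ne one_ne_zero] with n hn
  rw [eulerSeries_eq_prod_mul hx0 hx1 z n, mul_div_cancel_right₀ _ hn]

/-- The infinite form of Euler's theorem on partitions into odd and into distinct parts:
`∏ (1 + x^{2i}) · ∏_{i odd} (1 - x^{2i}) = 1`. -/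
lemma tendsto_prod_mul_prod_odd :
    Tendsto (fun n => (∏ i ∈ range n, (1 + x ^ (2 * i + 2))) *
      ∏ i ∈ range n, (1 - x ^ (2 * (2 * i + 1)))) atTop (𝓝 1) := by
  have hsum : Summable fun i : ℕ => -x ^ (2 * i + 2) :=
    (summable_pow_affine hx0 hx1 (by norm_num) 2).neg
  have hne : ∏' i : ℕ, (1 + -x ^ (2 * i + 2)) ≠ 0 :=
    tprod_one_add_ne_zero_of_summable
      (fun i => by simpa [← sub_eq_add_neg] using
        (one_sub_pow_pos_s17 hx0 hx1 (n := 2 * i + 2) (by omega)).ne') hsum.norm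
  have ht := tendsto_prod_range_one_add hsum
  have ht2 := ht.comp (tendsto_id.const_mul_atTop' (show 0 < 2 by norm_num))
  have h := ht2.div ht hne
  rw [div_self hne] at h
  refine h.congr fun n => ?_
  have hpos : ∏ i ∈ range n, (1 + -x ^ (2 * i + 2)) ≠ 0 :=
    prod_ne_zero_iff.2 fun i _ => by
      simpa [← sub_eq_add_neg] using (one_sub_pow_pos_s17 hx0 hx1 (n := 2 * i + 2) (by omega)).ne'
  simp only [Pi.div_apply, Function.comp_apply, id_eq]
  rw [div_eq_iff hpos, ← prod_mul_distrib, ← prod_mul_distrib]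
  clear hpos
  induction n with
  | zero => simp
  | succ n ih =>
    rw [Nat.mul_succ, prod_range_succ, prod_range_succ, prod_range_succ, ih]
    ring

end Euler

/-! ### The Markov chain -/

/-- The law `δ₀ Pⁿ`. -/
def herLaw (q : ℝ) (n : ℕ) : ℕ → ℝ := (applyP (PHer q))^[n] delta0

/-- The action of `P_Her` on functions, `f ↦ P f`. -/
def herOp (q : ℝ) (f : ℕ → ℝ) (i : ℕ) : ℝ := ∑ j ∈ range (i + 2), PHer q i j * f j

section Chain

variable (q : ℝ)

lemma PHer_eq_zero {i j : ℕ} (h : i + 1 < j ∨ j + 1 < i) : PHer q i j = 0 := by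
  unfold PHer
  split_ifs <;> first | rfl | omega

lemma applyP_PHer_zero (μ : ℕ → ℝ) :
    applyP (PHer q) μ 0 = μ 0 * (1 - q⁻¹) + μ 1 * (1 - q⁻¹ ^ 2) := by
  unfold applyP
  rw [tsum_eq_sum (s := range 2) fun i hi => by
    rw [PHer_eq_zero q (by simp at hi; omega), mul_zero]]
  simp [sum_range_succ, PHer]

lemma applyP_PHer_succ (μ : ℕ → ℝ) (j : ℕ) :
    applyP (PHer q) μ (j + 1) = μ j * q⁻¹ ^ (2 * j + 1) +
      μ (j + 1) * (q⁻¹ ^ (2 * (j + 1)) * (1 - q⁻¹)) +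
      μ (j + 2) * (1 - q⁻¹ ^ (2 * (j + 2))) := by
  unfold applyP
  rw [tsum_eq_sum (s := range (j + 3)) fun i hi => by
    rw [PHer_eq_zero q (by simp at hi; omega), mul_zero]]
  rw [sum_range_succ, sum_range_succ, sum_range_succ, sum_eq_zero fun i hi => by
    rw [PHer_eq_zero q (by simp at hi; omega), mul_zero]]
  simp [PHer]

lemma herOp_zero (f : ℕ → ℝ) : herOp q f 0 = (1 - q⁻¹) * f 0 + q⁻¹ * f 1 := by
  simp [herOp, sum_range_succ, PHer]

lemma herOp_succ (f : ℕ → ℝ) (i : ℕ) :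
    herOp q f (i + 1) = (1 - q⁻¹ ^ (2 * (i + 1))) * f i +
      q⁻¹ ^ (2 * (i + 1)) * (1 - q⁻¹) * f (i + 1) + q⁻¹ ^ (2 * (i + 1) + 1) * f (i + 2) := by
  unfold herOp
  rw [sum_range_succ, sum_range_succ, sum_range_succ, sum_eq_zero fun j hj => by
    rw [PHer_eq_zero q (by simp at hj; omega), zero_mul]]
  have h : i ≠ i + 1 + 1 := by omega
  simp [PHer, h]

lemma herLaw_succ (n : ℕ) : herLaw q (n + 1) = applyP (PHer q) (herLaw q n) :=
  Function.iterate_succ_apply' _ _ _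

lemma herLaw_eq_zero {n j : ℕ} (h : n < j) : herLaw q n j = 0 := by
  induction n generalizing j with
  | zero => simp [herLaw, delta0]; omega
  | succ n ih =>
    obtain ⟨j, rfl⟩ : ∃ k, j = k + 1 := ⟨j - 1, by omega⟩
    rw [herLaw_succ, applyP_PHer_succ, ih (by omega), ih (by omega), ih (by omega)]
    ring

lemma tsum_herLaw_mul {n m : ℕ} (h : n < m) (f : ℕ → ℝ) :
    ∑' j, herLaw q n j * f j = ∑ j ∈ range m, herLaw q n j * f j :=
  tsum_eq_sum fun j hj => by
    rw [herLaw_eq_zero q (by simp at hj; omega), zero_mul]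

lemma summable_herLaw_mul (n : ℕ) (f : ℕ → ℝ) : Summable fun j => herLaw q n j * f j :=
  summable_of_ne_finset_zero (s := range (n + 1)) fun j hj => by
    rw [herLaw_eq_zero q (by simp at hj; omega), zero_mul]

lemma tsum_herLaw_zero_mul (f : ℕ → ℝ) : ∑' j, herLaw q 0 j * f j = f 0 := by
  rw [tsum_herLaw_mul q zero_lt_one]
  simp [herLaw, delta0]

/-- Duality between the actions of `P_Her` on measures and on functions. -/
lemma tsum_herLaw_succ_mul (n : ℕ) (f : ℕ → ℝ) :
    ∑' j, herLaw q (n + 1) j * f j = ∑' i, herLaw q n i * herOp q f i := by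
  have hstep : ∀ j, herLaw q (n + 1) j = ∑ i ∈ range (n + 1), herLaw q n i * PHer q i j :=
    fun j => by rw [herLaw_succ, ← tsum_herLaw_mul q n.lt_succ_self]; rfl
  rw [tsum_herLaw_mul q (Nat.lt_succ_self (n + 1)), tsum_herLaw_mul q n.lt_succ_self]
  simp only [hstep, sum_mul]
  rw [sum_comm]
  refine sum_congr rfl fun i hi => ?_
  rw [herOp, mul_sum]
  simp only [mul_assoc]
  refine (sum_subset (range_mono (by simp at hi; omega)) fun j _ hj => ?_).symm
  rw [PHer_eq_zero q (by simp at hj; omega)]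
  ring

lemma tsum_herLaw (n : ℕ) : ∑' j, herLaw q n j = 1 := by
  have h : herOp q (fun _ => 1) = fun _ => 1 := by
    funext i
    rcases i with _ | i
    · rw [herOp_zero]; ring
    · rw [herOp_succ]; ring
  have : ∑' j, herLaw q n j * (fun _ => (1 : ℝ)) j = 1 := by
    induction n with
    | zero => rw [tsum_herLaw_zero_mul]
    | succ n ih => rw [tsum_herLaw_succ_mul, h, ih]
  simpa using this

variable {q}

lemma tsum_herLaw_mul_neg_pow (hq : q ≠ 0) (n : ℕ) :
    ∑' j, herLaw q n j * (-q) ^ j = (-q⁻¹) ^ n := by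
  have h : herOp q (fun j => (-q) ^ j) = fun j => -q⁻¹ * (-q) ^ j := by
    funext i
    rcases i with _ | i
    · rw [herOp_zero]; field_simp; ring
    · rw [herOp_succ, pow_succ _ (2 * (i + 1))]
      generalize q⁻¹ ^ (2 * (i + 1)) = t
      rw [pow_add, pow_succ]
      field_simp
      ring
  induction n with
  | zero => rw [tsum_herLaw_zero_mul]; simp
  | succ n ih =>
    rw [tsum_herLaw_succ_mul, h, pow_succ, ← ih, ← tsum_mul_right]
    exact tsum_congr fun j => by ring

variable (hq : 1 < q)
include hq

/-- Reversibility of `P_Her` with respect to the weights `eulerCoeff`. -/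
lemma herOp_herLaw_div (n : ℕ) :
    herOp q (fun j => herLaw q n j / eulerCoeff q⁻¹ j) =
      fun j => herLaw q (n + 1) j / eulerCoeff q⁻¹ j := by
  have hx0 : 0 < q⁻¹ := by positivity
  have hx1 : q⁻¹ < 1 := inv_lt_one_of_one_lt₀ hq
  have hc := fun j => (eulerCoeff_pos hx0 hx1 j).ne'
  have hs := eulerCoeff_succ hx0 hx1
  have key : ∀ i (a : ℝ), q⁻¹ ^ (2 * i + 1) * (a / eulerCoeff q⁻¹ (i + 1)) =
      a * (1 - q⁻¹ ^ (2 * (i + 1))) / eulerCoeff q⁻¹ i := fun i a => by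
    rw [mul_div_assoc', div_eq_div_iff (hc _) (hc _)]
    linear_combination -a * hs i
  have key' : ∀ i (a : ℝ), (1 - q⁻¹ ^ (2 * (i + 1))) * (a / eulerCoeff q⁻¹ i) =
      a * q⁻¹ ^ (2 * i + 1) / eulerCoeff q⁻¹ (i + 1) := fun i a => by
    rw [mul_div_assoc', div_eq_div_iff (hc _) (hc _)]
    linear_combination a * hs i
  funext i
  rcases i with _ | i
  · rw [herOp_zero, herLaw_succ, applyP_PHer_zero]
    have := key 0 (herLaw q n 1)
    norm_num at this ⊢
    rw [this]
    ring
  · rw [herOp_succ, herLaw_succ, applyP_PHer_succ, key', key]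
    ring

lemma tsum_herLaw_mul_herLaw_div (m n : ℕ) :
    ∑' j, herLaw q m j * (herLaw q n j / eulerCoeff q⁻¹ j) = herLaw q (m + n) 0 := by
  induction n generalizing m with
  | zero =>
    rw [tsum_eq_single 0 fun j hj => by simp [herLaw, delta0, hj]]
    simp [herLaw, delta0, eulerCoeff]
  | succ n ih =>
    have h := tsum_herLaw_succ_mul q m fun j => herLaw q n j / eulerCoeff q⁻¹ j
    rw [herOp_herLaw_div hq, ih, add_right_comm] at h
    exact h.symm

lemma herLaw_eq (n : ℕ) : ∀ j k : ℕ, j + k = n → herLaw q n j = eulerCoeff q⁻¹ j *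
    (∏ i ∈ range n, (1 - q⁻¹ ^ (2 * (i + 1)))) / ∏ i ∈ range k, (1 - (-q⁻¹) ^ (i + 1)) := by
  have hx0 : 0 < q⁻¹ := by positivity
  have hx1 : q⁻¹ < 1 := inv_lt_one_of_one_lt₀ hq
  have hs := eulerCoeff_succ hx0 hx1
  have hd := one_sub_neg_pow_ne_zero hx0 hx1
  have hK : ∀ k : ℕ, ∏ i ∈ range k, (1 - (-q⁻¹) ^ (i + 1)) ≠ 0 := fun k =>
    prod_ne_zero_iff.2 fun i _ => hd i
  induction n with
  | zero =>
    intro j k h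
    obtain ⟨rfl, rfl⟩ : j = 0 ∧ k = 0 := by omega
    simp [herLaw, delta0, eulerCoeff]
  | succ n ih =>
    have hup : ∀ j k : ℕ, j + k = n → herLaw q n (j + 1) * (1 - q⁻¹ ^ (2 * (j + 1))) =
        q⁻¹ ^ (2 * j + 1) * (1 - (-q⁻¹) ^ k) * herLaw q n j := by
      intro j k h
      rcases k with _ | k
      · rw [herLaw_eq_zero q (by omega)]; simp
      · rw [ih (j + 1) k (by omega), ih j (k + 1) h, prod_range_succ _ k]
        have hKk := hK k
        have hdk := hd k
        have hsj := hs j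
        generalize q⁻¹ = x at *
        field_simp
        linear_combination (∏ i ∈ range n, (1 - x ^ (2 * (i + 1)))) * hsj
    have hsq : q⁻¹ ^ (2 * (n + 1)) = ((-q⁻¹) ^ (n + 1)) ^ 2 := by
      rw [← pow_mul, mul_comm (n + 1), pow_mul, pow_mul, neg_sq]
    intro j k h
    rw [herLaw_succ, prod_range_succ _ n, hsq]
    rcases j with _ | j
    · obtain rfl : k = n + 1 := by omega
      have hup0 := hup 0 n (by omega)
      simp only [mul_zero, zero_add, mul_one, pow_one] at hup0
      rw [applyP_PHer_zero, hup0, ih 0 n (by omega), prod_range_succ _ n]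
      have hKk := hK n
      have hdk := hd n
      rw [pow_succ (-q⁻¹) n] at *
      generalize (-q⁻¹) ^ n = t at *
      generalize ∏ i ∈ range n, (1 - (-q⁻¹) ^ (i + 1)) = K at *
      generalize q⁻¹ = x at *
      simp only [mul_neg, sub_neg_eq_add, mul_comm t x] at hdk ⊢
      field_simp
      ring
    rcases k with _ | k
    · obtain rfl : j = n := by omega
      rw [applyP_PHer_succ, herLaw_eq_zero q (show j < j + 1 by omega),
        herLaw_eq_zero q (show j < j + 2 by omega), ih j 0 (by omega), ← hsq]
      simp only [prod_range_zero]
      linear_combination -(∏ i ∈ range j, (1 - q⁻¹ ^ (2 * (i + 1)))) * hs j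
    · rw [applyP_PHer_succ, hup (j + 1) k (by omega), ih (j + 1) k (by omega),
        ih j (k + 1) (by omega), prod_range_succ _ k]
      have hpow : (-q⁻¹) ^ (n + 1) = (-q⁻¹) ^ (k + 1) * (-q⁻¹) ^ (j + 1) := by
        rw [← pow_add]; congr 1; omega
      have hpow2 : q⁻¹ ^ (2 * (j + 1)) = ((-q⁻¹) ^ (j + 1)) ^ 2 := by
        rw [← pow_mul, mul_comm (j + 1), pow_mul, pow_mul, neg_sq]
      have hKk := hK k
      have hdk := hd k
      have hsj := hs j
      rw [hpow, pow_succ _ (2 * (j + 1))]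
      rw [hpow2] at *
      generalize (-q⁻¹) ^ (j + 1) = s at *
      rw [pow_succ (-q⁻¹) k] at *
      generalize (-q⁻¹) ^ k = t at *
      generalize q⁻¹ ^ (2 * j + 1) = r at *
      generalize q⁻¹ = x at *
      simp only [mul_neg, sub_neg_eq_add, mul_comm t x] at hdk ⊢
      field_simp
      linear_combination -(∏ i ∈ range n, (1 - x ^ (2 * (i + 1)))) * hsj

lemma herLaw_zero_eq (n : ℕ) : herLaw q n 0 = ∏ i ∈ range n, (1 + (-q⁻¹) ^ (i + 1)) := by
  have hx0 : 0 < q⁻¹ := by positivity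
  have hx1 : q⁻¹ < 1 := inv_lt_one_of_one_lt₀ hq
  have hK : ∏ i ∈ range n, (1 - (-q⁻¹) ^ (i + 1)) ≠ 0 :=
    prod_ne_zero_iff.2 fun i _ => one_sub_neg_pow_ne_zero hx0 hx1 i
  rw [herLaw_eq hq n 0 n (by omega), div_eq_iff hK, ← prod_mul_distrib]
  simp only [eulerCoeff, pow_zero, ne_eq, OfNat.ofNat_ne_zero, not_false_eq_true, zero_pow,
    range_zero, prod_empty, div_one, one_mul]
  refine prod_congr rfl fun i _ => ?_
  rw [pow_mul, ← neg_sq, ← pow_mul, mul_comm 2, pow_mul]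
  ring

end Chain

/-! ### The constants and the return probabilities -/

section Constants

variable {q : ℝ} (hq : 1 < q)
include hq

lemma betaQ_eq_inv : betaQ q = (eulerSeries q⁻¹ 1)⁻¹ := by
  have hx0 : 0 < q⁻¹ := by positivity
  have hx1 : q⁻¹ < 1 := inv_lt_one_of_one_lt₀ hq
  have hs := summable_pow_affine hx0 hx1 (a := 2) (by norm_num) 1
  rw [betaQ, tprod_inv_one_add hs fun i => by positivity]
  congr 1
  refine tendsto_nhds_unique (tendsto_prod_range_one_add hs) ?_
  simpa using tendsto_prod_eulerSeries hx0 hx1 1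

lemma betaQ_pos : 0 < betaQ q := by
  rw [betaQ_eq_inv hq]
  exact inv_pos.2 (zero_lt_one.trans_le (one_le_eulerSeries (by positivity)
    (inv_lt_one_of_one_lt₀ hq) zero_le_one))

lemma eulerSeries_mul_alphaQsq : eulerSeries q⁻¹ q⁻¹ * alphaQsq q = 1 := by
  have hx0 : 0 < q⁻¹ := by positivity
  have hx1 : q⁻¹ < 1 := inv_lt_one_of_one_lt₀ hq
  have h1 := tendsto_prod_eulerSeries hx0 hx1 q⁻¹
  have h2 : Tendsto (fun n => ∏ i ∈ range n, (1 - q⁻¹ ^ (2 * (2 * i + 1)))) atTop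
      (𝓝 (alphaQsq q)) := by
    have hs := (summable_pow_affine hx0 hx1 (a := 4) (by norm_num) 2).neg
    have := tendsto_prod_range_one_add hs
    simp only [← sub_eq_add_neg] at this
    convert this using 5
    · ring
    · unfold alphaQsq
      congr! 4
      ring
  refine tendsto_nhds_unique (h1.mul h2) ?_
  refine (tendsto_prod_mul_prod_odd hx0 hx1).congr fun n => ?_
  congr 1
  exact prod_congr rfl fun i _ => by ring

lemma tendsto_herLaw_zero : Tendsto (fun m => herLaw q (2 * m) 0) atTop (𝓝 (betaQ q)) := by
  have hx0 : 0 < q⁻¹ := by positivity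
  have hx1 : q⁻¹ < 1 := inv_lt_one_of_one_lt₀ hq
  have h1 : Tendsto (fun n => ∏ i ∈ range n, (1 + 1 * q⁻¹ ^ (2 * i + 1))) atTop _ :=
    tendsto_prod_eulerSeries hx0 hx1 1
  have hne : eulerSeries q⁻¹ 1 ≠ 0 :=
    (zero_lt_one.trans_le (one_le_eulerSeries hx0 hx1 zero_le_one)).ne'
  have h := (tendsto_prod_mul_prod_odd hx0 hx1).div h1 hne
  rw [one_div, ← betaQ_eq_inv hq] at h
  refine h.congr fun n => ?_
  have hpos : ∏ i ∈ range n, (1 + 1 * q⁻¹ ^ (2 * i + 1)) ≠ 0 :=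
    (prod_pos fun i _ => by positivity).ne'
  rw [Pi.div_apply, div_eq_iff hpos, herLaw_zero_eq hq]
  clear hpos h
  induction n with
  | zero => simp
  | succ n ih =>
    rw [Nat.mul_succ]
    simp only [prod_range_succ]
    have hodd : (-q⁻¹) ^ (2 * n + 1) = -q⁻¹ ^ (2 * n + 1) := Odd.neg_pow ⟨n, rfl⟩ _
    have heven : (-q⁻¹) ^ (2 * n + 1 + 1) = q⁻¹ ^ (2 * n + 2) := Even.neg_pow ⟨n + 1, by ring⟩ _
    rw [hodd, heven]
    linear_combination (1 + q⁻¹ ^ (2 * n + 2)) * (1 - q⁻¹ ^ (2 * (2 * n + 1))) * ih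

end Constants

/-- A second-order bound for the return probabilities to `0`. -/
lemma herLaw_zero_le {q : ℝ} (hq : 3 ≤ q) (m : ℕ) :
    herLaw q (2 * m) 0 ≤ betaQ q *
      (1 + q⁻¹ ^ (2 * m + 1) / (1 + q⁻¹) + 2 / q⁻¹ * (q⁻¹ ^ (2 * m + 1)) ^ 2) := by
  have hq1 : 1 < q := by linarith
  have hx0 : 0 < q⁻¹ := by positivity
  have hx1 : q⁻¹ < 1 := inv_lt_one_of_one_lt₀ hq1
  have hx3 : q⁻¹ ≤ 1 / 3 := by
    rw [inv_le_comm₀ (by linarith) (by norm_num)]; linarith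
  have hstep : ∀ m, herLaw q (2 * (m + 1)) 0 = herLaw q (2 * m) 0 *
      ((1 - q⁻¹ ^ (2 * m + 1)) * (1 + q⁻¹ * q⁻¹ ^ (2 * m + 1))) := fun m => by
    rw [herLaw_zero_eq hq1, herLaw_zero_eq hq1, Nat.mul_succ, prod_range_succ, prod_range_succ]
    have hodd : (-q⁻¹) ^ (2 * m + 1) = -q⁻¹ ^ (2 * m + 1) := Odd.neg_pow ⟨m, rfl⟩ _
    have heven : (-q⁻¹) ^ (2 * m + 1 + 1) = q⁻¹ ^ (2 * m + 2) := Even.neg_pow ⟨m + 1, by ring⟩ _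
    rw [hodd, heven]
    ring
  have hpos : ∀ m, 0 < herLaw q (2 * m) 0 := fun m => by
    induction m with
    | zero => simp [herLaw, delta0]
    | succ m ih =>
      rw [hstep]
      have := one_sub_pow_pos_s17 hx0 hx1 (n := 2 * m + 1) (by omega)
      positivity
  have hβ := betaQ_pos hq1
  set b : ℕ → ℝ := fun m =>
    1 + q⁻¹ ^ (2 * m + 1) / (1 + q⁻¹) + 2 / q⁻¹ * (q⁻¹ ^ (2 * m + 1)) ^ 2 with hb
  have hanti : Antitone fun m => b m / herLaw q (2 * m) 0 := by
    refine antitone_nat_of_succ_le fun m => ?_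
    rw [div_le_div_iff₀ (hpos _) (hpos _), hstep]
    have hw0 : 0 < q⁻¹ ^ (2 * m + 1) := by positivity
    have hwx : q⁻¹ ^ (2 * m + 1) ≤ q⁻¹ := pow_le_of_le_one hx0.le hx1.le (by omega)
    have hw2 : q⁻¹ ^ (2 * (m + 1) + 1) = q⁻¹ ^ 2 * q⁻¹ ^ (2 * m + 1) := by ring
    have hR := hpos m
    simp only [hb, hw2]
    generalize q⁻¹ ^ (2 * m + 1) = w at *
    generalize herLaw q (2 * m) 0 = R at *
    generalize q⁻¹ = x at *
    have key : 1 + x ^ 2 * w / (1 + x) + 2 / x * (x ^ 2 * w) ^ 2 ≤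
        (1 + w / (1 + x) + 2 / x * w ^ 2) * ((1 - w) * (1 + x * w)) := by
      have hdiff : (1 + w / (1 + x) + 2 / x * w ^ 2) * ((1 - w) * (1 + x * w)) -
          (1 + x ^ 2 * w / (1 + x) + 2 / x * (x ^ 2 * w) ^ 2) =
          w ^ 2 / (x * (1 + x)) * (2 * (1 + x) * (1 - x ^ 4 - (1 - x) * w - x * w ^ 2)
            - x * (1 - x) - x ^ 2 * (1 + x) - x ^ 2 * w) := by
        field_simp
        ring
      have hx4 : x ^ 4 ≤ 1 / 81 := by
        calc x ^ 4 ≤ (1 / 3) ^ 4 := by gcongr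
          _ = _ := by norm_num
      have h1 : (1 - x) * w ≤ 1 / 3 := by nlinarith
      have h2 : x * w ^ 2 ≤ 1 / 27 := by
        calc x * w ^ 2 ≤ (1 / 3) * (1 / 3) ^ 2 := by gcongr; exact hwx.trans hx3
          _ = _ := by norm_num
      have h3 : x ^ 2 * w ≤ 1 / 27 := by
        calc x ^ 2 * w ≤ (1 / 3) ^ 2 * (1 / 3) := by gcongr; exact hwx.trans hx3
          _ = _ := by norm_num
      have h4 : x ^ 2 * (1 + x) ≤ 4 / 27 := by
        calc x ^ 2 * (1 + x) ≤ (1 / 3) ^ 2 * (1 + 1 / 3) := by gcongr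
          _ = _ := by norm_num
      have h5 : 0 ≤ 2 * (1 + x) * (1 - x ^ 4 - (1 - x) * w - x * w ^ 2)
            - x * (1 - x) - x ^ 2 * (1 + x) - x ^ 2 * w := by
        nlinarith
      have : 0 ≤ w ^ 2 / (x * (1 + x)) := by positivity
      linarith [mul_nonneg this h5]
    calc _ ≤ (1 + w / (1 + x) + 2 / x * w ^ 2) * ((1 - w) * (1 + x * w)) * R := by gcongr
      _ = _ := by ring
  have hlim : Tendsto (fun m => b m / herLaw q (2 * m) 0) atTop (𝓝 (1 / betaQ q)) := by
    refine Tendsto.div ?_ (tendsto_herLaw_zero hq1) hβ.ne'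
    have h := (summable_pow_affine hx0 hx1 (a := 2) (by norm_num) 1).tendsto_atTop_zero
    have := ((h.div_const (1 + q⁻¹)).const_add 1).add ((h.pow 2).const_mul (2 / q⁻¹))
    simpa [hb] using this
  have := hanti.le_of_tendsto hlim m
  rw [div_le_div_iff₀ hβ (hpos m)] at this
  linarith

/-! ### The stationary distribution and the first two eigenfunctions -/

lemma piHer_eq (q : ℝ) (j : ℕ) : piHer q j = betaQ q * eulerCoeff q⁻¹ j := by
  rw [piHer, eulerCoeff, inv_pow q (j ^ 2), div_mul_eq_div_div, ← mul_div_assoc,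
    div_eq_mul_inv _ (q ^ _)]

section Stationary

variable {q : ℝ} (hq : 1 < q)
include hq

lemma hasSum_eulerCoeff (z : ℝ) :
    HasSum (fun j => betaQ q * eulerCoeff q⁻¹ j * z ^ j) (betaQ q * eulerSeries q⁻¹ z) := by
  have h := (summable_eulerCoeff_mul_pow (x := q⁻¹) (by positivity)
    (inv_lt_one_of_one_lt₀ hq) z).hasSum.mul_left (betaQ q)
  simp only [← mul_assoc] at h
  exact h

lemma hasSum_piHer : HasSum (piHer q) 1 := by
  have h := hasSum_eulerCoeff hq 1
  have hb := (betaQ_pos hq).ne'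
  rw [← inv_inv (eulerSeries q⁻¹ 1), ← betaQ_eq_inv hq, mul_inv_cancel₀ hb] at h
  simpa only [one_pow, mul_one, ← piHer_eq] using h

lemma hasSum_piHer_mul_sq_pow : HasSum (fun j => piHer q j * (q ^ 2) ^ j) (q + 1) := by
  have hq0 : q ≠ 0 := by positivity
  have hb := (betaQ_pos hq).ne'
  have h := hasSum_eulerCoeff hq (q ^ 2)
  have h1 : q ^ 2 * q⁻¹ = q := by field_simp
  have h2 : q ^ 2 * q⁻¹ ^ 2 = 1 := by field_simp
  rw [eulerSeries_eq_mul (by positivity) (inv_lt_one_of_one_lt₀ hq), h1, h2,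
    ← inv_inv (eulerSeries q⁻¹ 1), ← betaQ_eq_inv hq] at h
  simp only [← piHer_eq] at h
  convert h using 1
  field_simp
  ring

lemma hasSum_piHer_mul_neg_pow : HasSum (fun j => piHer q j * (-q) ^ j) 0 := by
  have hq0 : q ≠ 0 := by positivity
  have h := hasSum_eulerCoeff hq (-q)
  rw [eulerSeries_eq_mul (by positivity) (inv_lt_one_of_one_lt₀ hq), neg_mul,
    mul_inv_cancel₀ hq0, add_neg_cancel, zero_mul, mul_zero] at h
  simpa only [← piHer_eq] using h

lemma hasSum_piHer_mul_pow :
    HasSum (fun j => piHer q j * q ^ j) (2 * betaQ q / alphaQsq q) := by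
  have hq0 : q ≠ 0 := by positivity
  have h := hasSum_eulerCoeff hq q
  have hα := eulerSeries_mul_alphaQsq hq
  have h2 : q * q⁻¹ ^ 2 = q⁻¹ := by field_simp
  rw [eulerSeries_eq_mul (by positivity) (inv_lt_one_of_one_lt₀ hq), h2,
    mul_inv_cancel₀ hq0, eq_inv_of_mul_eq_one_left hα] at h
  simp only [← piHer_eq] at h
  convert h using 1
  ring

/-- The weighted `ℓ²` norm of `δ₀ Pⁿ` minus its components on the first two eigenfunctions. -/
lemma hasSum_sq_div_piHer (n : ℕ) :
    HasSum (fun j => (herLaw q n j - piHer q j -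
        (-q⁻¹) ^ n / (q + 1) * (piHer q j * (-q) ^ j)) ^ 2 / piHer q j)
      ((betaQ q)⁻¹ * herLaw q (2 * n) 0 - 1 - q⁻¹ ^ (2 * n) / (q + 1)) := by
  have hq0 : q ≠ 0 := by positivity
  have hq1 : q + 1 ≠ 0 := by positivity
  have hc := fun j => (eulerCoeff_pos (x := q⁻¹) (by positivity) (inv_lt_one_of_one_lt₀ hq) j).ne'
  have hb := (betaQ_pos hq).ne'
  set κ := (-q⁻¹) ^ n / (q + 1) with hκ
  have h1 := ((summable_herLaw_mul q n _).hasSum_iff.2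
    (tsum_herLaw_mul_herLaw_div hq n n)).mul_left (betaQ q)⁻¹
  have h2 : HasSum (fun j => herLaw q n j) 1 :=
    (by simpa using summable_herLaw_mul q n (fun _ => 1) : Summable _).hasSum_iff.2
      (tsum_herLaw q n)
  have h3 := (summable_herLaw_mul q n _).hasSum_iff.2 (tsum_herLaw_mul_neg_pow hq0 n)
  have h4 := hasSum_piHer hq
  have h5 := (hasSum_piHer_mul_neg_pow hq).mul_left (2 * κ)
  have h6 := (hasSum_piHer_mul_sq_pow hq).mul_left (κ ^ 2)
  convert ((h1.sub ((h2.add (h3.mul_left κ)).mul_left 2)).add ((h4.add h5).add h6)) using 1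
  · rfl
  · funext j
    have hcj := hc j
    have hsq : (q ^ 2) ^ j = ((-q) ^ j) ^ 2 := by rw [← neg_sq, ← pow_mul, mul_comm, pow_mul]
    rw [piHer_eq, hsq]
    generalize eulerCoeff q⁻¹ j = c at *
    field_simp
    ring
  · have hx : q⁻¹ ^ (2 * n) = ((-q⁻¹) ^ n) ^ 2 := by
      rw [pow_mul, ← neg_sq, ← pow_mul, mul_comm, pow_mul]
    rw [hx, hκ, ← two_mul]
    field_simp
    ring

end Stationary

/-- The total variation estimate, for any real `q ≥ 3`. -/
lemma abs_tsum_abs_herLaw_sub_le {q : ℝ} (hq : 3 ≤ q) (n : ℕ) :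
    |(∑' i : ℕ, |herLaw q n i - piHer q i|) -
        (2 * betaQ q / ((q + 1) * alphaQsq q)) * q⁻¹ ^ n|
      ≤ √((betaQ q)⁻¹ ^ 2 - 1) * q⁻¹ ^ (2 * n) := by
  have hq1 : 1 < q := by linarith
  have hx0 : 0 < q⁻¹ := by positivity
  have hx1 : q⁻¹ < 1 := inv_lt_one_of_one_lt₀ hq1
  have hβ := betaQ_pos hq1
  have hπ : ∀ j, 0 < piHer q j := fun j => by
    rw [piHer_eq]
    exact mul_pos hβ (eulerCoeff_pos hx0 hx1 j)
  set L : ℕ → ℝ := fun j => (-q⁻¹) ^ n / (q + 1) * (piHer q j * (-q) ^ j) with hL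
  have hLabs : HasSum (fun j => |L j|) (2 * betaQ q / ((q + 1) * alphaQsq q) * q⁻¹ ^ n) := by
    convert (hasSum_piHer_mul_pow hq1).mul_left (q⁻¹ ^ n / (q + 1)) using 1
    · rfl
    · funext j
      rw [hL, abs_mul, abs_div, abs_pow, abs_neg, abs_of_pos hx0,
        abs_of_pos (show 0 < q + 1 by positivity), abs_mul, abs_of_pos (hπ j), abs_pow, abs_neg,
        abs_of_pos (show 0 < q by positivity)]
    · rw [div_mul_div_comm]
      ring
  -- the remainder is controlled by its weighted `ℓ²` norm
  have hS := hasSum_sq_div_piHer hq1 n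
  set S := (betaQ q)⁻¹ * herLaw q (2 * n) 0 - 1 - q⁻¹ ^ (2 * n) / (q + 1) with hSdef
  have hβinv : 1 + q⁻¹ ≤ (betaQ q)⁻¹ := by
    rw [betaQ_eq_inv hq1, inv_inv, eulerSeries_eq_mul hx0 hx1, one_mul]
    exact le_mul_of_one_le_right (by positivity) (one_le_eulerSeries hx0 hx1 (by positivity))
  have hD : 2 * q⁻¹ ≤ (betaQ q)⁻¹ ^ 2 - 1 := by nlinarith
  have hDpos : 0 < (betaQ q)⁻¹ ^ 2 - 1 := by linarith
  set t := √((betaQ q)⁻¹ ^ 2 - 1) * q⁻¹ ^ (2 * n) with ht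
  have htpos : 0 < t := mul_pos (Real.sqrt_pos.2 hDpos) (by positivity)
  have hSt : S ≤ t ^ 2 := by
    have h := herLaw_zero_le hq n
    rw [← inv_mul_le_iff₀ hβ] at h
    have e1 : q⁻¹ ^ (2 * n + 1) / (1 + q⁻¹) = q⁻¹ ^ (2 * n) / (q + 1) := by
      rw [pow_succ]
      field_simp
    have e2 : 2 / q⁻¹ * (q⁻¹ ^ (2 * n + 1)) ^ 2 = 2 * q⁻¹ * (q⁻¹ ^ (2 * n)) ^ 2 := by
      rw [pow_succ q⁻¹ (2 * n)]
      generalize q⁻¹ ^ (2 * n) = w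
      field_simp
    rw [e1, e2] at h
    rw [ht, mul_pow, Real.sq_sqrt hDpos.le]
    calc S ≤ 2 * q⁻¹ * (q⁻¹ ^ (2 * n)) ^ 2 := by linarith
      _ ≤ _ := by gcongr
  have hbound : ∀ j, |herLaw q n j - piHer q j - L j| ≤
      t / 2 * piHer q j + 1 / (2 * t) *
        ((herLaw q n j - piHer q j - L j) ^ 2 / piHer q j) := fun j => by
    have hp := hπ j
    rw [← sq_abs (herLaw q n j - piHer q j - L j)]
    generalize |herLaw q n j - piHer q j - L j| = r
    generalize piHer q j = p at hp
    have : 0 ≤ (r - t * p) ^ 2 / (2 * t * p) := by positivity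
    have e : (r - t * p) ^ 2 / (2 * t * p) = t / 2 * p + 1 / (2 * t) * (r ^ 2 / p) - r := by
      field_simp
      ring
    linarith
  have hmaj := ((hasSum_piHer hq1).mul_left (t / 2)).add (hS.mul_left (1 / (2 * t)))
  have hRs : Summable fun j => |herLaw q n j - piHer q j - L j| :=
    Summable.of_nonneg_of_le (fun _ => abs_nonneg _) hbound hmaj.summable
  have hR : ∑' j, |herLaw q n j - piHer q j - L j| ≤ t := by
    refine (hRs.tsum_le_tsum hbound hmaj.summable).trans ?_
    rw [hmaj.tsum_eq]
    calc t / 2 * 1 + 1 / (2 * t) * S ≤ t / 2 * 1 + 1 / (2 * t) * t ^ 2 := by gcongr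
      _ = t := by field_simp; ring
  have hdiff : Summable fun j => |herLaw q n j - piHer q j| := by
    refine Summable.of_nonneg_of_le (fun _ => abs_nonneg _) (fun j => ?_)
      (hRs.add hLabs.summable)
    simpa using abs_add_le (herLaw q n j - piHer q j - L j) (L j)
  rw [← hLabs.tsum_eq, ← hdiff.tsum_sub hLabs.summable]
  refine le_trans ?_ hR
  have hsub : ∀ j, |(|herLaw q n j - piHer q j| - |L j|)| ≤ |herLaw q n j - piHer q j - L j| :=
    fun j => abs_abs_sub_abs_le_abs_sub _ _
  have hnorm : Summable fun j => ‖|herLaw q n j - piHer q j| - |L j|‖ :=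
    (hdiff.sub hLabs.summable).abs
  exact (norm_tsum_le_tsum_norm hnorm).trans (hnorm.tsum_le_tsum hsub hRs)

/-- For every odd prime power `q` and `n ≥ 1`,
`|‖δ₀P_Her^n − π_Her‖_tv − (2β(q)/((q+1)·α(q²)))·q^{−n}| ≤ (β(q)^{−2} − 1)^{1/2}·q^{−2n}`. -/
theorem stmt17 (q : ℕ) (hq : IsPrimePow q) (hodd : Odd q) (n : ℕ) (hn : 1 ≤ n) :
    |(∑' i : ℕ, |(applyP (PHer q))^[n] delta0 i - piHer q i|)
        - (2 * betaQ q / (((q : ℝ) + 1) * alphaQsq q)) * (q : ℝ)⁻¹ ^ n|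
      ≤ Real.sqrt ((betaQ q)⁻¹ ^ 2 - 1) * (q : ℝ)⁻¹ ^ (2 * n) := by
  have h1 := hq.one_lt
  obtain ⟨k, hk⟩ := hodd
  exact abs_tsum_abs_herLaw_sub_le (by exact_mod_cast (by omega : 3 ≤ q)) n
end
end
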